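/- (Hopf–Tsuji–Sullivan dichotomy on the horofunction boundary.) Suppose G contains a contracting element and let {μ_x}_{x∈Y} be an ω-dimensional G-equivariant conformal density on ∂_hY for some ω > 0. Then the following are equivalent: (1) the Poincaré series P_G(s,o,o) diverges at s = ω; (2) the set Λ_c(G) of conical points has positive μ_o-measure; (3) Λ_c(G) has full μ_o-measure. Moreover, if these statements hold then ω = ω_G. -/

import Mathlib

open Metric Filter Topology Set MeasureTheory Pointwise

noncomputable section

namespace ConfDyn

/-- `γ` is (the image of) a geodesic segment from `x` to `y`. -/
def IsGeodesicIn (Y : Type*) [MetricSpace Y] (γ : Set Y) (x y : Y) : Prop :=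
  ∃ f : ℝ → Y, f 0 = x ∧ f (dist x y) = y ∧
    (∀ s ∈ Set.Icc (0 : ℝ) (dist x y), ∀ t ∈ Set.Icc (0 : ℝ) (dist x y),
      dist (f s) (f t) = |s - t|) ∧
    γ = f '' Set.Icc (0 : ℝ) (dist x y)

/-- `Y` is a geodesic metric space. -/
def GeodesicSpace (Y : Type*) [MetricSpace Y] : Prop :=
  ∀ x y : Y, ∃ γ : Set Y, IsGeodesicIn Y γ x y

/-- the shortest projection of the point `y` to the subset `X`. -/
def projSet {Y : Type*} [MetricSpace Y] (X : Set Y) (y : Y) : Set Y :=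
  {x ∈ X | dist y x = Metric.infDist y X}

/-- the shortest projection of the subset `A` to the subset `X`. -/
def projSetOf {Y : Type*} [MetricSpace Y] (X A : Set Y) : Set Y :=
  ⋃ a ∈ A, projSet X a

/-- `d_X(x,y)`, the diameter of `π_X(x) ∪ π_X(y)`. -/
def projDist {Y : Type*} [MetricSpace Y] (X : Set Y) (x y : Y) : ENNReal :=
  EMetric.diam (projSet X x ∪ projSet X y)

/-- `X` is a `C`-contracting subset: any geodesic segment at distance at least `C`
from `X` has shortest projection to `X` of diameter at most `C`. -/
def IsContractingSet {Y : Type*} [MetricSpace Y] (C : ℝ) (X : Set Y) : Prop :=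
  ∀ x y : Y, ∀ γ : Set Y, IsGeodesicIn Y γ x y →
    (∀ p ∈ γ, C ≤ Metric.infDist p X) →
    EMetric.diam (projSetOf X γ) ≤ ENNReal.ofReal C

/-- the Busemann function based at `o` associated to `y`, `b_y(x) = d(x,y) - d(o,y)`. -/
def busemannCM {Y : Type*} [MetricSpace Y] (o y : Y) : C(Y, ℝ) :=
  ⟨fun x => dist x y - dist o y,
    (continuous_id.dist continuous_const).sub continuous_const⟩

/-- the horofunction compactification of `Y`: the closure of `{b_y : y ∈ Y}` in
`C(Y,ℝ)` with the compact-open topology. -/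
def horoCpt (Y : Type*) [MetricSpace Y] (o : Y) : Set C(Y, ℝ) :=
  closure (Set.range (busemannCM o))

/-- `ξ` is a point of the horofunction boundary `∂_h Y`. -/
def IsHoroPoint {Y : Type*} [MetricSpace Y] (o : Y) (ξ : C(Y, ℝ)) : Prop :=
  ξ ∈ horoCpt Y o ∧ ∀ y : Y, ξ ≠ busemannCM o y

/-- a sequence of points of `Y` converges to `ξ` in the horofunction compactification. -/
def HoroConv {Y : Type*} [MetricSpace Y] (o : Y) (u : ℕ → Y) (ξ : C(Y, ℝ)) : Prop :=
  Filter.Tendsto (fun n => busemannCM o (u n)) atTop (nhds ξ)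

/-- two horofunctions have (K-)finite difference for some K. -/
def FinDiff {Y : Type*} [MetricSpace Y] (ξ η : C(Y, ℝ)) : Prop :=
  ∃ K : ℝ, ∀ z : Y, |ξ z - η z| ≤ K

/-- the locus of a subset of the horofunction boundary. -/
def locus {Y : Type*} [MetricSpace Y] (o : Y) (Λ : Set C(Y, ℝ)) : Set C(Y, ℝ) :=
  {η | IsHoroPoint o η ∧ ∃ ξ ∈ Λ, FinDiff ξ η}

/-- the finite-difference relation as a setoid on `C(Y,ℝ)`. -/
def finDiffSetoid (Y : Type*) [MetricSpace Y] : Setoid C(Y, ℝ) where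
  r := FinDiff
  iseqv := ⟨fun ξ => ⟨0, fun z => by simp⟩,
    fun h => h.imp (fun K hK z => by rw [abs_sub_comm]; exact hK z),
    fun h₁ h₂ => by
      obtain ⟨K₁, hK₁⟩ := h₁
      obtain ⟨K₂, hK₂⟩ := h₂
      exact ⟨K₁ + K₂, fun z => (abs_sub_le _ _ _).trans (add_le_add (hK₁ z) (hK₂ z))⟩⟩

/-- the limit set of a subset `X ⊆ Y` in the horofunction boundary. -/
def limitSetOf {Y : Type*} [MetricSpace Y] (o : Y) (X : Set Y) : Set C(Y, ℝ) :=
  {ξ | IsHoroPoint o ξ ∧ ∃ u : ℕ → Y, (∀ n, u n ∈ X) ∧ HoroConv o u ξ}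

/-- accumulation points of a sequence of points of `Y` in the horofunction boundary. -/
def accPoints {Y : Type*} [MetricSpace Y] (o : Y) (u : ℕ → Y) : Set C(Y, ℝ) :=
  {ξ | IsHoroPoint o ξ ∧ ∃ φ : ℕ → ℕ, StrictMono φ ∧ HoroConv o (u ∘ φ) ξ}

/-- `X` is a quasi-geodesic: the image of a quasi-isometric embedding of a real interval. -/
def IsQuasiGeodesicSet {Y : Type*} [MetricSpace Y] (X : Set Y) : Prop :=
  ∃ (c : ℝ) (I : Set ℝ) (φ : ℝ → Y), 1 ≤ c ∧ I.OrdConnected ∧ X = φ '' I ∧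
    ∀ s ∈ I, ∀ t ∈ I,
      (1 / c) * |s - t| - c ≤ dist (φ s) (φ t) ∧ dist (φ s) (φ t) ≤ c * |s - t| + c

section GroupAction

variable {Y : Type*} [MetricSpace Y] {G : Type*} [Group G] [MulAction G Y]

/-- `G` acts by isometries on `Y`. -/
def IsometricAction (G Y : Type*) [Group G] [MulAction G Y] [MetricSpace Y] : Prop :=
  ∀ g : G, Isometry (fun y : Y => g • y)

/-- the action of `G` on `Y` is (metrically) proper. -/
def ProperAction (G Y : Type*) [Group G] [MulAction G Y] [MetricSpace Y] : Prop :=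
  ∀ B : Set Y, Bornology.IsBounded B → Set.Finite {g : G | (g • B) ∩ B ≠ ∅}

/-- `G` is non-elementary: no finite-index subgroup is trivial or infinite cyclic. -/
def NonElementary (G : Type*) [Group G] : Prop :=
  ∀ H : Subgroup G, H.index ≠ 0 → ∀ g : G, H ≠ Subgroup.zpowers g

/-- the orbit of `o` under the cyclic group generated by `f`. -/
def cyclicOrbit (o : Y) (f : G) : Set Y :=
  {y : Y | ∃ n : ℤ, y = f ^ n • o}

/-- `f` is a contracting element with `C`-contracting orbit: it has infinite order,
`n ↦ fⁿ • o` is a quasi-isometric embedding of `ℤ`, and `⟨f⟩ • o` is `C`-contracting. -/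
def IsContractingElt (o : Y) (C : ℝ) (f : G) : Prop :=
  (∀ n : ℤ, n ≠ 0 → f ^ n ≠ 1) ∧
  (∃ c : ℝ, 1 ≤ c ∧ ∀ m n : ℤ,
      (1 / c) * |(m : ℝ) - (n : ℝ)| - c ≤ dist (f ^ m • o) (f ^ n • o) ∧
      dist (f ^ m • o) (f ^ n • o) ≤ c * |(m : ℝ) - (n : ℝ)| + c) ∧
  IsContractingSet C (cyclicOrbit o f)

/-- `f` is a contracting element. -/
def IsContractingEltAny (o : Y) (f : G) : Prop :=
  ∃ C : ℝ, 1 ≤ C ∧ IsContractingElt o C f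

/-- the elementary group `E(f)`: elements moving `⟨f⟩ • o` a finite Hausdorff distance. -/
def EGroup (o : Y) (f : G) : Set G :=
  {g : G | EMetric.hausdorffEdist (g • cyclicOrbit o f) (cyclicOrbit o f) ≠ ⊤}

/-- the axis `Ax(f) = E(f) • o`. -/
def axisOf (o : Y) (f : G) : Set Y :=
  (fun g : G => g • o) '' EGroup o f

/-- the family of all `G`-translated axes of `h` and `k`. -/
def axesPairFam (o : Y) (h k : G) : Set (Set Y) :=
  {S | ∃ g : G, S = g • axisOf o h ∨ S = g • axisOf o k}

/-- `h` and `k` are independent contracting elements: the family of their translated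
axes has bounded projection. -/
def IndepElts (o : Y) (h k : G) : Prop :=
  ∃ B : ℝ, 0 < B ∧ ∀ U ∈ axesPairFam o h k, ∀ V ∈ axesPairFam o h k,
    U ≠ V → EMetric.diam (projSetOf U V) ≤ ENNReal.ofReal B

/-- the family of all `G`-translated axes of the triple `f₁, f₂, f₃`. -/
def axesTripleFam (o : Y) (f₁ f₂ f₃ : G) : Set (Set Y) :=
  {S | ∃ g : G, S = g • axisOf o f₁ ∨ S = g • axisOf o f₂ ∨ S = g • axisOf o f₃}

/-- `F = {f₁,f₂,f₃}` is an admissible triple with constants `C`, `B₀`: three pairwise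
independent contracting elements whose translated axes are `C`-contracting with
`B₀`-bounded projection. -/
def IsAdmissibleTriple (o : Y) (C B₀ : ℝ) (f₁ f₂ f₃ : G) : Prop :=
  f₁ ≠ f₂ ∧ f₁ ≠ f₃ ∧ f₂ ≠ f₃ ∧
  IsContractingEltAny o f₁ ∧ IsContractingEltAny o f₂ ∧ IsContractingEltAny o f₃ ∧
  IndepElts o f₁ f₂ ∧ IndepElts o f₁ f₃ ∧ IndepElts o f₂ f₃ ∧
  (∀ S ∈ axesTripleFam o f₁ f₂ f₃, IsContractingSet C S) ∧
  (∀ U ∈ axesTripleFam o f₁ f₂ f₃, ∀ V ∈ axesTripleFam o f₁ f₂ f₃,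
    U ≠ V → EMetric.diam (projSetOf U V) ≤ ENNReal.ofReal B₀)

/-- the geodesic `γ` contains an `(r,f)`-barrier at `g • o`. -/
def HasBarrier (o : Y) (r : ℝ) (f g : G) (γ : Set Y) : Prop :=
  Metric.infDist (g • o) γ ≤ r ∧ Metric.infDist ((g * f) • o) γ ≤ r

/-- the partial cone `Ω_x^F(g • o, r)`. -/
def partialCone (o x : Y) (f₁ f₂ f₃ : G) (g : G) (r : ℝ) : Set Y :=
  {z | ∃ γ : Set Y, IsGeodesicIn Y γ x z ∧
      (HasBarrier o r f₁ g γ ∨ HasBarrier o r f₂ g γ ∨ HasBarrier o r f₃ g γ)}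

/-- the partial shadow `Π_x^F(g • o, r)`: accumulation points of the partial cone in
the horofunction boundary. -/
def partialShadow (o x : Y) (f₁ f₂ f₃ : G) (g : G) (r : ℝ) : Set C(Y, ℝ) :=
  {ξ | IsHoroPoint o ξ ∧ ∃ u : ℕ → Y, (∀ n, u n ∈ partialCone o x f₁ f₂ f₃ g r) ∧
      HoroConv o u ξ}

/-- `ξ` is an `(r,F)`-conical point. -/
def IsConicalPt (o : Y) (f₁ f₂ f₃ : G) (r : ℝ) (ξ : C(Y, ℝ)) : Prop :=
  ∃ g₀ : G, Set.Infinite {g : G | ξ ∈ partialShadow o (g₀ • o) f₁ f₂ f₃ g r}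

/-- the usual cone `Ω_x(y,r)`. -/
def usualCone (x y : Y) (r : ℝ) : Set Y :=
  {z | ∃ γ : Set Y, IsGeodesicIn Y γ x z ∧ ∃ p ∈ γ, dist p y ≤ r}

/-- the usual shadow `Π_x(y,r)`. -/
def usualShadow (o x y : Y) (r : ℝ) : Set C(Y, ℝ) :=
  {ξ | IsHoroPoint o ξ ∧ ∃ u : ℕ → Y, (∀ n, u n ∈ usualCone x y r) ∧ HoroConv o u ξ}

/-- the set `Λ_c(G)` of conical points of the action. -/
def conicalSet (G : Type*) {Y : Type*} [Group G] [MulAction G Y] [MetricSpace Y]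
    (o : Y) : Set C(Y, ℝ) :=
  {ξ | ∃ r : ℝ, 0 < r ∧ ∃ g₀ : G, ∃ u : ℕ → G,
      Filter.Tendsto (fun n => dist o (u n • o)) atTop atTop ∧
      ∀ n, ξ ∈ usualShadow o (g₀ • o) (u n • o) r}

/-- the attracting fixed-point set `[h⁺]`: the locus of the accumulation points of
`{hⁿ o : n > 0}` in the horofunction boundary. -/
def attrFix (o : Y) (h : G) : Set C(Y, ℝ) :=
  locus o (accPoints o (fun n : ℕ => h ^ (n + 1) • o))

/-- the repelling fixed-point set `[h⁻]`. -/
def repFix (o : Y) (h : G) : Set C(Y, ℝ) :=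
  locus o (accPoints o (fun n : ℕ => h ^ (-(n + 1) : ℤ) • o))

/-- the limit set `Λ G y` of the orbit `G • y` in the horofunction boundary. -/
def orbitLimitSet (G : Type*) {Y : Type*} [Group G] [MulAction G Y] [MetricSpace Y]
    (o y : Y) : Set C(Y, ℝ) :=
  {ξ | IsHoroPoint o ξ ∧ ∃ u : ℕ → G,
      Filter.Tendsto (fun n => busemannCM o (u n • y)) atTop (nhds ξ)}

/-- the action of an isometry `g` on horofunctions. -/
def horoAct [ContinuousConstSMul G Y] (o : Y) (g : G) (ξ : C(Y, ℝ)) : C(Y, ℝ) :=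
  ⟨fun y => ξ (g⁻¹ • y) - ξ (g⁻¹ • o),
    (ξ.continuous.comp (continuous_const_smul g⁻¹)).sub continuous_const⟩

/-- the number of orbit points of `Γ ⊆ G` in the closed ball of radius `R` around `o`. -/
def orbitCount (G : Type*) {Y : Type*} [Group G] [MulAction G Y] [MetricSpace Y]
    (o : Y) (Γ : Set G) (R : ℝ) : ℕ :=
  Nat.card {g : G // g ∈ Γ ∧ dist o (g • o) ≤ R}

/-- the critical exponent `ω_Γ` of a subset `Γ ⊆ G`. -/
def critExp (G : Type*) {Y : Type*} [Group G] [MulAction G Y] [MetricSpace Y]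
    (o : Y) (Γ : Set G) : ℝ :=
  Filter.limsup (fun R : ℝ => Real.log (orbitCount G o Γ R) / R) atTop

/-- an `ω`-dimensional `G`-equivariant conformal density on the horofunction boundary:
a family of finite measures supported on `∂_h Y`, normalized at `o`, `G`-equivariant,
with conformal derivative `dμ_x/dμ_y(ξ) = e^{-ω·B_ξ(x,y)}`. -/
def IsConformalDensity (G : Type*) {Y : Type*} [Group G] [MulAction G Y] [MetricSpace Y]
    [ContinuousConstSMul G Y] [MeasurableSpace C(Y, ℝ)]
    (o : Y) (ω : ℝ) (μ : Y → MeasureTheory.Measure C(Y, ℝ)) : Prop :=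
  (∀ x : Y, MeasureTheory.IsFiniteMeasure (μ x)) ∧
  (∀ x : Y, μ x {ξ : C(Y, ℝ) | ¬ IsHoroPoint o ξ} = 0) ∧
  μ o Set.univ = 1 ∧
  (∀ g : G, ∀ x : Y, MeasureTheory.Measure.map (horoAct o g) (μ x) = μ (g • x)) ∧
  (∀ x y : Y, μ x = (μ y).withDensity
      (fun ξ : C(Y, ℝ) => ENNReal.ofReal (Real.exp (-ω * (ξ x - ξ y)))))

end GroupAction

section ContractingGeometry

variable {Y : Type*} [MetricSpace Y]

theorem IsGeodesicIn.dist_add_dist {γ : Set Y} {x y u : Y} (hγ : IsGeodesicIn Y γ x y)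
    (hu : u ∈ γ) : dist x u + dist u y = dist x y := by
  obtain ⟨f, h0, h1, hf, rfl⟩ := hγ
  obtain ⟨t, ht, rfl⟩ := hu
  have a := hf 0 ⟨le_rfl, dist_nonneg⟩ t ht
  have b := hf t ht _ ⟨dist_nonneg, le_rfl⟩
  rw [h0] at a
  rw [h1] at b
  rw [a, b, zero_sub, abs_neg, abs_of_nonneg ht.1, abs_sub_comm,
    abs_of_nonneg (sub_nonneg.2 ht.2)]
  ring

theorem IsGeodesicIn.smul {G : Type*} [Group G] [MulAction G Y] (hiso : IsometricAction G Y)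
    {γ : Set Y} {x y : Y} (hγ : IsGeodesicIn Y γ x y) (g : G) :
    IsGeodesicIn Y (g • γ) (g • x) (g • y) := by
  obtain ⟨f, h0, h1, hf, rfl⟩ := hγ
  have e : dist (g • x) (g • y) = dist x y := (hiso g).dist_eq x y
  refine ⟨fun t => g • f t, congrArg (g • ·) h0, by simp only [e, h1], ?_, ?_⟩
  · rw [e]
    intro s hs t ht
    rw [← hf s hs t ht]
    exact (hiso g).dist_eq _ _
  · rw [e, ← Set.image_smul, Set.image_image]

theorem dist_smul_smul {G : Type*} [Group G] [MulAction G Y] (hiso : IsometricAction G Y)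
    (g : G) (x y : Y) : dist (g • x) (g • y) = dist x y :=
  (hiso g).dist_eq x y

theorem IsContractingSet.dist_le_of_mem {C : ℝ} {X : Set Y} (hX : IsContractingSet C X)
    (hC : 0 ≤ C) {x y : Y} {γ : Set Y} (hγ : IsGeodesicIn Y γ x y)
    (hfar : ∀ p ∈ γ, C ≤ Metric.infDist p X) {a b p q : Y} (ha : a ∈ γ) (hb : b ∈ γ)
    (hp : p ∈ projSet X a) (hq : q ∈ projSet X b) : dist p q ≤ C := by
  have h := hX x y γ hγ hfar
  have h2 : edist p q ≤ ENNReal.ofReal C :=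
    (Metric.edist_le_ediam_of_mem (Set.mem_biUnion ha hp) (Set.mem_biUnion hb hq)).trans h
  rwa [edist_dist, ENNReal.ofReal_le_ofReal_iff hC] at h2

/-- A geodesic between two points whose projections to a contracting set are far apart
passes close to the projection of its starting point. -/
theorem IsContractingSet.exists_dist_le {C : ℝ} {X : Set Y} (hX : IsContractingSet C X)
    (hC : 0 ≤ C) (hproj : ∀ y, (projSet X y).Nonempty) {w z p q : Y}
    (hp : p ∈ projSet X w) (hq : q ∈ projSet X z) (hpq : C < dist p q) {γ : Set Y}
    (hγ : IsGeodesicIn Y γ w z) : ∃ u ∈ γ, dist u p ≤ 2 * C := by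
  have hγ' := hγ
  obtain ⟨f, h0, h1, hf, rfl⟩ := hγ
  have hfc : ContinuousOn f (Icc 0 (dist w z)) := by
    have : LipschitzOnWith 1 f (Icc 0 (dist w z)) :=
      LipschitzOnWith.of_dist_le_mul fun s hs t ht => by
        rw [hf s hs t ht, Real.dist_eq]; simp
    exact this.continuousOn
  have hhc : ContinuousOn (fun t => Metric.infDist (f t) X) (Icc 0 (dist w z)) :=
    (Metric.continuous_infDist_pt X).comp_continuousOn hfc
  have h0m : (0 : ℝ) ∈ Icc 0 (dist w z) := ⟨le_rfl, dist_nonneg⟩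
  have h1m : dist w z ∈ Icc 0 (dist w z) := ⟨dist_nonneg, le_rfl⟩
  rcases lt_or_ge (Metric.infDist w X) C with hw | hw
  · exact ⟨w, ⟨0, h0m, h0⟩, by rw [hp.2]; linarith⟩
  by_cases hex : ∃ t ∈ Icc 0 (dist w z), Metric.infDist (f t) X ≤ C
  swap
  · push Not at hex
    refine absurd (hX.dist_le_of_mem hC hγ' ?_ ⟨0, h0m, h0⟩ ⟨_, h1m, h1⟩ hp hq) hpq.not_ge
    rintro _ ⟨t, ht, rfl⟩
    exact (hex t ht).le
  have hcl : IsCompact (Icc 0 (dist w z) ∩ (fun t => Metric.infDist (f t) X) ⁻¹' Iic C) :=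
    isCompact_Icc.of_isClosed_subset (hhc.preimage_isClosed_of_isClosed isClosed_Icc isClosed_Iic)
      inter_subset_left
  obtain ⟨t₀, ⟨ht₀, ht₀C⟩, hmin⟩ := hcl.exists_isLeast hex
  have hsub : Icc 0 t₀ ⊆ Icc 0 (dist w z) := Icc_subset_Icc_right ht₀.2
  have hlow : ∀ s ∈ Icc 0 t₀, C ≤ Metric.infDist (f s) X := by
    intro s hs
    by_contra! hlt
    obtain ⟨r, hr, hrC⟩ := intermediate_value_Icc' hs.1
      (hhc.mono ((Icc_subset_Icc_right hs.2).trans hsub)) ⟨hlt.le, by rwa [h0]⟩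
    have hrC' : Metric.infDist (f r) X = C := hrC
    have hle := hmin ⟨hsub ⟨hr.1, hr.2.trans hs.2⟩, hrC'.le⟩
    have : r = s := le_antisymm hr.2 (hs.2.trans hle)
    rw [this] at hrC'
    exact hlt.ne hrC'
  have hd : dist w (f t₀) = t₀ := by
    rw [← h0, hf 0 h0m t₀ ht₀, zero_sub, abs_neg, abs_of_nonneg ht₀.1]
  have hseg : IsGeodesicIn Y (f '' Icc 0 t₀) w (f t₀) := by
    refine ⟨f, h0, by rw [hd], ?_, by rw [hd]⟩
    rw [hd]
    exact fun s hs t ht => hf s (hsub hs) t (hsub ht)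
  obtain ⟨v, hv⟩ := hproj (f t₀)
  have h1 := hX.dist_le_of_mem hC hseg (by rintro _ ⟨s, hs, rfl⟩; exact hlow s hs)
    ⟨0, ⟨le_rfl, ht₀.1⟩, h0⟩ ⟨t₀, ⟨ht₀.1, le_rfl⟩, rfl⟩ hp hv
  have h2 : dist (f t₀) v ≤ C := hv.2.trans_le ht₀C
  refine ⟨f t₀, ⟨t₀, ht₀, rfl⟩, ?_⟩
  have := dist_triangle (f t₀) v p
  rw [dist_comm v p] at this
  linarith

theorem self_mem_projSet {X : Set Y} {x : Y} (hx : x ∈ X) : x ∈ projSet X x :=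
  ⟨hx, by rw [dist_self, Metric.infDist_zero_of_mem hx]⟩

theorem IsContractingSet.dist_add_dist_le {C : ℝ} {X : Set Y} (hX : IsContractingSet C X)
    (hC : 0 ≤ C) (hY : GeodesicSpace Y) (hproj : ∀ y, (projSet X y).Nonempty) {z p x : Y}
    (hp : p ∈ projSet X z) (hx : x ∈ X) : dist z p + dist p x ≤ dist z x + 4 * C := by
  rcases lt_or_ge C (dist p x) with h | h
  · obtain ⟨γ, hγ⟩ := hY z x
    obtain ⟨u, hu, hup⟩ := hX.exists_dist_le hC hproj hp (self_mem_projSet hx) h hγ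
    have h1 := hγ.dist_add_dist hu
    have h2 := dist_triangle z u p
    have h3 := dist_triangle p u x
    rw [dist_comm p u] at h3
    linarith
  · have : dist z p ≤ dist z x := hp.2.trans_le (Metric.infDist_le_dist_of_mem hx)
    linarith

end ContractingGeometry

section CyclicOrbit

variable {Y G : Type*} [MetricSpace Y] [Group G] [MulAction G Y] {o : Y} {C : ℝ} {f : G}

theorem mem_projSet_cyclicOrbit {z : Y} {n : ℤ}
    (h : ∀ m : ℤ, dist z (f ^ n • o) ≤ dist z (f ^ m • o)) :
    f ^ n • o ∈ projSet (cyclicOrbit o f) z := by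
  refine ⟨⟨n, rfl⟩, le_antisymm ?_ (Metric.infDist_le_dist_of_mem ⟨n, rfl⟩)⟩
  refine (Metric.le_infDist (s := cyclicOrbit o f) ⟨_, n, rfl⟩).2 ?_
  rintro _ ⟨m, rfl⟩
  exact h m

theorem IsContractingElt.exists_le_dist (hf : IsContractingElt o C f) :
    ∃ c : ℝ, 1 ≤ c ∧ ∀ n : ℤ, (1 / c) * |(n : ℝ)| - c ≤ dist o (f ^ n • o) := by
  obtain ⟨-, ⟨c, hc, h⟩, -⟩ := hf
  refine ⟨c, hc, fun n => ?_⟩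
  have := (h 0 n).1
  rwa [zpow_zero, one_smul, Int.cast_zero, zero_sub, abs_neg] at this

theorem IsContractingElt.tendsto_dist (hf : IsContractingElt o C f) (z : Y) :
    Tendsto (fun n : ℤ => dist z (f ^ n • o)) cofinite atTop := by
  obtain ⟨c, hc, h⟩ := hf.exists_le_dist
  have h1 : Tendsto (fun n : ℤ => |(n : ℝ)|) cofinite atTop := by
    have := tendsto_norm_cocompact_atTop.comp Int.tendsto_coe_cofinite
    simpa [Function.comp_def, Real.norm_eq_abs] using this
  have h2 : Tendsto (fun n : ℤ => (1 / c) * |(n : ℝ)| + (-c - dist z o)) cofinite atTop :=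
    tendsto_atTop_add_const_right _ _ (h1.const_mul_atTop (by positivity))
  refine tendsto_atTop_mono (fun n => ?_) h2
  have := dist_triangle o z (f ^ n • o)
  rw [dist_comm o z] at this
  linarith [h n]

theorem IsContractingElt.exists_forall_dist_le (hf : IsContractingElt o C f) (z : Y) :
    ∃ n : ℤ, ∀ m : ℤ, dist z (f ^ n • o) ≤ dist z (f ^ m • o) :=
  (hf.tendsto_dist z).exists_forall_le

theorem IsContractingElt.projSet_nonempty (hf : IsContractingElt o C f) (z : Y) :
    (projSet (cyclicOrbit o f) z).Nonempty :=
  let ⟨_, hn⟩ := hf.exists_forall_dist_le z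
  ⟨_, mem_projSet_cyclicOrbit hn⟩

theorem IsContractingElt.finite_dist_le (hf : IsContractingElt o C f) (R : ℝ) :
    {n : ℤ | dist o (f ^ n • o) ≤ R}.Finite := by
  have := (hf.tendsto_dist o).eventually_gt_atTop R
  rw [Filter.eventually_cofinite] at this
  simpa using this

theorem IsContractingElt.exists_lt_dist (hf : IsContractingElt o C f) (R : ℝ) :
    ∃ n : ℤ, R < dist o (f ^ n • o) :=
  ((hf.tendsto_dist o).eventually_gt_atTop R).exists

theorem IsContractingElt.summable_exp (hf : IsContractingElt o C f) {ω : ℝ} (hω : 0 < ω) :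
    Summable fun n : ℤ => Real.exp (-ω * dist o (f ^ n • o)) := by
  obtain ⟨c, hc, h⟩ := hf.exists_le_dist
  have hneg : -(ω / c) < 0 := by
    have : 0 < ω / c := by positivity
    linarith
  have hs := (Real.summable_exp_nat_mul_iff.2 hneg).mul_left (Real.exp (ω * c))
  have key : ∀ n : ℤ, Real.exp (-ω * dist o (f ^ n • o)) ≤
      Real.exp (ω * c) * Real.exp (|(n : ℝ)| * -(ω / c)) := by
    intro n
    rw [← Real.exp_add]
    refine Real.exp_le_exp.2 ?_
    have := mul_le_mul_of_nonneg_left (h n) hω.le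
    have e : ω * (1 / c * |(n : ℝ)| - c) = |(n : ℝ)| * (ω / c) - ω * c := by ring
    linarith
  refine summable_int_iff_summable_nat_and_neg.2 ⟨?_, ?_⟩
  · refine Summable.of_nonneg_of_le (fun _ => (Real.exp_pos _).le) (fun n => ?_) hs
    simpa using key n
  · refine Summable.of_nonneg_of_le (fun _ => (Real.exp_pos _).le) (fun n => ?_) hs
    simpa using key (-n)

end CyclicOrbit

section EscapeSets

variable {Y G : Type*} [MetricSpace Y] [Group G] [MulAction G Y]

/-- The elements `g` for which `g • o` is a shortest projection of `o` to `g⟨f⟩ • o`. -/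
def minReps (o : Y) (f : G) : Set G :=
  {g | ∀ n : ℤ, dist o (g • o) ≤ dist o ((g * f ^ n) • o)}

/-- The functions that, along `g⟨f⟩ • o`, do not behave like the distance to a point
projecting close to `g • o`. -/
def escapeSet (o : Y) (f : G) (C : ℝ) (g : G) : Set C(Y, ℝ) :=
  {ξ | ∀ m : ℤ, dist o (f ^ m • o) ≤ C → ∃ n : ℤ,
    ξ ((g * f ^ n) • o) < ξ ((g * f ^ m) • o) + dist (f ^ n • o) (f ^ m • o) - 4 * C}

variable {o : Y} {C : ℝ} {f : G}

theorem IsContractingElt.isOpen_escapeSet (hf : IsContractingElt o C f) (g : G) :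
    IsOpen (escapeSet o f C g) := by
  have : escapeSet o f C g = ⋂ m ∈ {m : ℤ | dist o (f ^ m • o) ≤ C}, ⋃ n : ℤ,
      {ξ : C(Y, ℝ) | ξ ((g * f ^ n) • o) <
        ξ ((g * f ^ m) • o) + dist (f ^ n • o) (f ^ m • o) - 4 * C} := by
    ext ξ
    simp [escapeSet]
  rw [this]
  refine (hf.finite_dist_le C).isOpen_biInter fun m _ => isOpen_iUnion fun n => ?_
  exact isOpen_lt (by fun_prop) (by fun_prop)

theorem IsContractingElt.exists_dist_le_of_mem_escapeSet (hf : IsContractingElt o C f)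
    (hC : 0 ≤ C) (hY : GeodesicSpace Y) (hiso : IsometricAction G Y) {k g : G}
    (hg : g ∈ minReps o f) {z : Y} (hz : busemannCM o z ∈ escapeSet o f C (k * g))
    {γ : Set Y} (hγ : IsGeodesicIn Y γ (k • o) z) :
    ∃ u ∈ γ, dist u ((k * g) • o) ≤ 2 * C := by
  have hd : ∀ n : ℤ, dist ((k * g * f ^ n) • o) z = dist ((k * g)⁻¹ • z) (f ^ n • o) := by
    intro n
    rw [← dist_smul_smul hiso (k * g) ((k * g)⁻¹ • z), smul_inv_smul, smul_smul, dist_comm]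
  obtain ⟨m, hm⟩ := hf.exists_forall_dist_le ((k * g)⁻¹ • z)
  have hq := mem_projSet_cyclicOrbit hm
  have hp : o ∈ projSet (cyclicOrbit o f) ((k * g)⁻¹ • k • o) := by
    have e : ∀ x : Y, dist ((k * g)⁻¹ • k • o) x = dist o (g • x) := by
      intro x
      rw [← dist_smul_smul hiso g, smul_smul, smul_smul]
      simp
    have := mem_projSet_cyclicOrbit (o := o) (f := f) (z := (k * g)⁻¹ • k • o) (n := 0) <| by
      intro n
      rw [e, e, smul_smul, smul_smul, zpow_zero, mul_one]
      exact hg n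
    rwa [zpow_zero, one_smul] at this
  have hfar : C < dist o (f ^ m • o) := by
    by_contra! hle
    obtain ⟨n, hn⟩ := hz m hle
    have h1 := hf.2.2.dist_add_dist_le hC hY hf.projSet_nonempty hq (x := f ^ n • o) ⟨n, rfl⟩
    simp only [busemannCM, ContinuousMap.coe_mk, hd] at hn
    rw [dist_comm (f ^ m • o)] at h1
    linarith
  obtain ⟨u, hu, hup⟩ := hf.2.2.exists_dist_le hC hf.projSet_nonempty hp hq hfar
    (hγ.smul hiso (k * g)⁻¹)
  obtain ⟨v, hv, rfl⟩ := hu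
  refine ⟨v, hv, ?_⟩
  rw [← dist_smul_smul hiso (k * g)⁻¹, inv_smul_smul]
  exact hup

/-- Near a horofunction in an open set `U` there are points of `Y` with Busemann function
in `U`. -/
theorem IsHoroPoint.exists_seq [ProperSpace Y] {ξ : C(Y, ℝ)} (hξ : IsHoroPoint o ξ)
    {U : Set C(Y, ℝ)} (hU : IsOpen U) (hmem : ξ ∈ U) :
    ∃ u : ℕ → Y, (∀ n, busemannCM o (u n) ∈ U) ∧ HoroConv o u ξ := by
  have h1 : ξ ∈ closure (U ∩ Set.range (busemannCM o)) :=
    hU.inter_closure ⟨hmem, hξ.1⟩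
  obtain ⟨v, hv, hlim⟩ := mem_closure_iff_seq_limit.1 h1
  choose u hu using fun n => (hv n).2
  refine ⟨u, fun n => (hu n) ▸ (hv n).1, ?_⟩
  simpa only [HoroConv, hu] using hlim

theorem IsContractingElt.mem_usualShadow [ProperSpace Y] (hf : IsContractingElt o C f)
    (hC : 0 ≤ C) (hY : GeodesicSpace Y) (hiso : IsometricAction G Y) {k g : G}
    (hg : g ∈ minReps o f) {ξ : C(Y, ℝ)} (hξ : IsHoroPoint o ξ)
    (hmem : ξ ∈ escapeSet o f C (k * g)) :
    ξ ∈ usualShadow o (k • o) ((k * g) • o) (2 * C) := by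
  obtain ⟨u, hu, hlim⟩ := hξ.exists_seq (hf.isOpen_escapeSet _) hmem
  refine ⟨hξ, u, fun n => ?_, hlim⟩
  obtain ⟨γ, hγ⟩ := hY (k • o) (u n)
  exact ⟨γ, hγ, hf.exists_dist_le_of_mem_escapeSet hC hY hiso hg (hu n) hγ⟩

/-- If the sets of two minimal representatives meet on the boundary, then the shorter of the
two almost lies on the way to the longer one. -/
theorem IsContractingElt.dist_add_dist_le_of_mem_escapeSet [ProperSpace Y]
    (hf : IsContractingElt o C f)
    (hC : 0 ≤ C) (hY : GeodesicSpace Y) (hiso : IsometricAction G Y) {g h : G}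
    (hg : g ∈ minReps o f) (hh : h ∈ minReps o f) {ξ : C(Y, ℝ)} (hξ : IsHoroPoint o ξ)
    (hξg : ξ ∈ escapeSet o f C g) (hξh : ξ ∈ escapeSet o f C h)
    (hle : dist o (g • o) ≤ dist o (h • o)) :
    dist o (g • o) + dist o ((g⁻¹ * h) • o) ≤ dist o (h • o) + 16 * C := by
  obtain ⟨u, hu, -⟩ := hξ.exists_seq
    ((hf.isOpen_escapeSet g).inter (hf.isOpen_escapeSet h)) ⟨hξg, hξh⟩
  have key : ∀ k ∈ minReps o f, busemannCM o (u 0) ∈ escapeSet o f C k → ∀ γ,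
      IsGeodesicIn Y γ o (u 0) → ∃ v ∈ γ, dist v (k • o) ≤ 2 * C := by
    intro k hk hmem γ hγ
    have := hf.exists_dist_le_of_mem_escapeSet hC hY hiso (k := 1) (z := u 0) (γ := γ) hk
      (by rwa [one_mul]) (by rwa [one_smul])
    rwa [one_mul] at this
  obtain ⟨γ, hγ⟩ := hY o (u 0)
  obtain ⟨a, ha, hag⟩ := key g hg (hu 0).1 γ hγ
  obtain ⟨b, hb, hbh⟩ := key h hh (hu 0).2 γ hγ
  have hab : dist a b = |dist o a - dist o b| := by
    obtain ⟨φ, h0, h1, hφ, rfl⟩ := hγ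
    obtain ⟨s, hs, rfl⟩ := ha
    obtain ⟨t, ht, rfl⟩ := hb
    have z : (0 : ℝ) ∈ Icc 0 (dist o (u 0)) := ⟨le_rfl, dist_nonneg⟩
    have e1 := hφ 0 z s hs
    have e2 := hφ 0 z t ht
    rw [h0, zero_sub, abs_neg, abs_of_nonneg hs.1] at e1
    rw [h0, zero_sub, abs_neg, abs_of_nonneg ht.1] at e2
    rw [hφ s hs t ht, e1, e2]
  have hgh : dist o ((g⁻¹ * h) • o) = dist (g • o) (h • o) := by
    rw [← dist_smul_smul hiso g, smul_smul, mul_inv_cancel_left]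
  have t1 := dist_triangle o a (g • o)
  have t2 := dist_triangle o (g • o) a
  have t3 := dist_triangle o b (h • o)
  have t4 := dist_triangle o (h • o) b
  have t5 := dist_triangle4 (g • o) a b (h • o)
  rw [dist_comm (g • o) a] at t2 t5
  rw [dist_comm (h • o) b] at t4
  rw [hgh]
  rcases abs_cases (dist o a - dist o b) with ⟨e, -⟩ | ⟨e, -⟩ <;> linarith

theorem IsContractingElt.exists_mem_minReps (hf : IsContractingElt o C f)
    (hiso : IsometricAction G Y) (g : G) :
    ∃ t ∈ minReps o f, ∃ n : ℤ, g = t * f ^ n := by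
  have hd : ∀ n : ℤ, dist (g⁻¹ • o) (f ^ n • o) = dist o ((g * f ^ n) • o) := by
    intro n
    rw [← dist_smul_smul hiso g, smul_inv_smul, smul_smul]
  obtain ⟨m, hm⟩ := hf.exists_forall_dist_le (g⁻¹ • o)
  refine ⟨g * f ^ m, fun n => ?_, -m, by simp [mul_assoc]⟩
  have := hm (m + n)
  rwa [hd, hd, zpow_add, ← mul_assoc] at this

theorem dist_add_dist_le_of_mem_minReps (hf : IsContractingElt o C f) (hC : 0 ≤ C)
    (hY : GeodesicSpace Y) (hiso : IsometricAction G Y) {t : G} (ht : t ∈ minReps o f) (n : ℤ) :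
    dist o (t • o) + dist o (f ^ n • o) ≤ dist o ((t * f ^ n) • o) + 4 * C := by
  have hd : ∀ n : ℤ, dist (t⁻¹ • o) (f ^ n • o) = dist o ((t * f ^ n) • o) := by
    intro n
    rw [← dist_smul_smul hiso t, smul_inv_smul, smul_smul]
  have hd0 : dist (t⁻¹ • o) o = dist o (t • o) := by simpa using hd 0
  have hp : o ∈ projSet (cyclicOrbit o f) (t⁻¹ • o) := by
    have := mem_projSet_cyclicOrbit (o := o) (f := f) (z := t⁻¹ • o) (n := 0) <| by
      intro n
      rw [hd n, zpow_zero, one_smul, hd0]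
      exact ht n
    rwa [zpow_zero, one_smul] at this
  have := hf.2.2.dist_add_dist_le hC hY hf.projSet_nonempty hp (x := f ^ n • o) ⟨n, rfl⟩
  rwa [hd, hd0] at this

/-- Two translates far apart along the axis cover everything. -/
theorem mem_escapeSet_or (hiso : IsometricAction G Y) {N : ℤ}
    (hN : 6 * C < dist o (f ^ N • o)) (ξ : C(Y, ℝ)) :
    ξ ∈ escapeSet o f C 1 ∨ ξ ∈ escapeSet o f C (f ^ N) := by
  by_contra! h
  obtain ⟨h1, h2⟩ := h
  simp only [escapeSet, mem_ofPred_eq, not_forall, not_exists, not_lt] at h1 h2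
  obtain ⟨a, ha, h1⟩ := h1
  obtain ⟨b, hb, h2⟩ := h2
  have e1 := h1 (N + b)
  have e2 := h2 (-N + a)
  rw [one_mul, one_mul] at e1
  rw [← zpow_add, ← zpow_add, add_neg_cancel_left] at e2
  have d1 : dist (f ^ (-N + a) • o) (f ^ b • o) = dist (f ^ (N + b) • o) (f ^ a • o) := by
    rw [← dist_smul_smul hiso (f ^ N), smul_smul, smul_smul, ← zpow_add, ← zpow_add,
      add_neg_cancel_left, dist_comm]
  have d2 : dist (f ^ N • o) (f ^ (N + b) • o) = dist o (f ^ b • o) := by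
    rw [zpow_add, ← smul_smul, dist_smul_smul hiso]
  have t := dist_triangle4 o (f ^ a • o) (f ^ (N + b) • o) (f ^ N • o)
  rw [dist_comm (f ^ a • o), dist_comm (f ^ (N + b) • o) (f ^ N • o), d2] at t
  linarith

theorem horoAct_mem_escapeSet [ContinuousConstSMul G Y] (k g : G) (ξ : C(Y, ℝ)) :
    horoAct o k ξ ∈ escapeSet o f C g ↔ ξ ∈ escapeSet o f C (k⁻¹ * g) := by
  refine forall_congr' fun m => imp_congr_right fun _ => exists_congr fun n => ?_
  simp only [horoAct, ContinuousMap.coe_mk, smul_smul, mul_assoc]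
  constructor <;> intro h <;> linarith

end EscapeSets

section SecondMoment

open Classical in
theorem sum_indicator_one_eq_card {Ω ι : Type*} {A : ι → Set Ω} (s : Finset ι) (x : Ω) :
    ∑ i ∈ s, (A i).indicator (1 : Ω → ℝ) x = ((s.filter fun i => x ∈ A i).card : ℝ) := by
  simp [Set.indicator_apply, Finset.sum_boole]

variable {Ω ι : Type*} [MeasurableSpace Ω] {μ : Measure Ω} [IsFiniteMeasure μ] {A : ι → Set Ω}

theorem integral_sum_indicator_one (hA : ∀ i, MeasurableSet (A i)) (s : Finset ι) :
    ∫ x, ∑ i ∈ s, (A i).indicator (1 : Ω → ℝ) x ∂μ = ∑ i ∈ s, μ.real (A i) := by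
  have hi : ∀ i ∈ s, Integrable ((A i).indicator (1 : Ω → ℝ)) μ := fun i _ =>
    (integrable_const (1 : ℝ)).indicator (hA i)
  rw [integral_finsetSum _ hi]
  exact Finset.sum_congr rfl fun i _ => integral_indicator_one (hA i)

theorem integrable_sum_indicator_one (hA : ∀ i, MeasurableSet (A i)) (s : Finset ι) :
    Integrable (fun x => ∑ i ∈ s, (A i).indicator (1 : Ω → ℝ) x) μ :=
  integrable_finsetSum _ fun i _ => (integrable_const (1 : ℝ)).indicator (hA i)

open Classical in
theorem sum_measureReal_le_of_card_le (hA : ∀ i, MeasurableSet (A i)) (s : Finset ι) {K : ℝ}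
    (hK : ∀ᵐ x ∂μ, ((s.filter fun i => x ∈ A i).card : ℝ) ≤ K) :
    ∑ i ∈ s, μ.real (A i) ≤ K * μ.real Set.univ := by
  rw [← integral_sum_indicator_one hA]
  refine (integral_mono_ae (integrable_sum_indicator_one hA s) (integrable_const K) ?_).trans ?_
  · filter_upwards [hK] with x hx
    rwa [sum_indicator_one_eq_card]
  · rw [integral_const, smul_eq_mul, mul_comm]

/-- A second moment converse to the Borel–Cantelli lemma for quasi-independent events. -/
theorem measure_infinite_pos_of_sum_inter_le (hA : ∀ i, MeasurableSet (A i)) (F : ℕ → Finset ι)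
    {K : ℝ} (hK0 : 0 < K)
    (hdiv : Tendsto (fun n => ∑ i ∈ F n, μ.real (A i)) atTop atTop)
    (hK : ∀ᶠ n in atTop, ∑ i ∈ F n, ∑ j ∈ F n, μ.real (A i ∩ A j) ≤
      K * (∑ i ∈ F n, μ.real (A i)) ^ 2) :
    0 < μ {x | {i | x ∈ A i}.Infinite} := by
  classical
  by_contra hzero
  have hzero : μ {x | {i | x ∈ A i}.Infinite} = 0 := by simpa using hzero
  let Z : ℕ → Ω → ℝ := fun n x => ∑ i ∈ F n, (A i).indicator (1 : Ω → ℝ) x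
  have hZm : ∀ n, Measurable (Z n) := fun n =>
    Finset.measurable_fun_sum _ fun i _ => measurable_one.indicator (hA i)
  let B : ℕ → Set Ω := fun k => {x | ∀ n, Z n x ≤ k}
  have hBm : ∀ k, MeasurableSet (B k) := fun k => by
    have : B k = ⋂ n, {x | Z n x ≤ k} := by ext; simp [B]
    rw [this]
    exact MeasurableSet.iInter fun n => measurableSet_le (hZm n) measurable_const
  have hanti : Antitone fun k => (B k)ᶜ := by
    intro k l hkl
    refine Set.compl_subset_compl.2 fun x hx n => (hx n).trans ?_
    exact_mod_cast hkl
  have hInter : μ (⋂ k, (B k)ᶜ) = 0 := by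
    refine measure_mono_null (fun x hx => ?_) hzero
    rw [mem_ofPred_eq]
    intro hfin
    rw [Set.mem_iInter] at hx
    refine hx hfin.toFinset.card fun n => ?_
    simp only [Z, sum_indicator_one_eq_card]
    refine Nat.cast_le.2 (Finset.card_le_card fun i hi => ?_)
    simpa using (Finset.mem_filter.1 hi).2
  have hlim := tendsto_measure_iInter_atTop (μ := μ) (fun k => (hBm k).compl.nullMeasurableSet)
    hanti ⟨0, measure_ne_top _ _⟩
  rw [hInter] at hlim
  have hlim' := (ENNReal.tendsto_toReal ENNReal.zero_ne_top).comp hlim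
  obtain ⟨k, hk⟩ := (hlim'.eventually_lt_const
    (show (0 : ENNReal).toReal < 1 / (2 * K) by simpa using hK0)).exists
  have hk : μ.real (B k)ᶜ < 1 / (2 * K) := hk
  obtain ⟨n, hn, hnK⟩ := ((hdiv.eventually_gt_atTop (4 * (k * μ.real univ))).and hK).exists
  set S := ∑ i ∈ F n, μ.real (A i) with hS
  have hSpos : 0 < S := lt_of_le_of_lt (by positivity) hn
  have hsq : ∀ x, Z n x ^ 2 =
      ∑ p ∈ F n ×ˢ F n, (A p.1 ∩ A p.2).indicator (1 : Ω → ℝ) x := by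
    intro x
    simp only [Z, sq, Finset.sum_mul_sum, Finset.sum_product]
    refine Finset.sum_congr rfl fun i _ => Finset.sum_congr rfl fun j _ => ?_
    by_cases h1 : x ∈ A i <;> by_cases h2 : x ∈ A j <;> simp [h1, h2]
  have hAA : ∀ p : ι × ι, MeasurableSet (A p.1 ∩ A p.2) := fun p => (hA _).inter (hA _)
  have hint2 : ∫ x, Z n x ^ 2 ∂μ = ∑ i ∈ F n, ∑ j ∈ F n, μ.real (A i ∩ A j) := by
    simp only [hsq]
    rw [integral_sum_indicator_one (A := fun p : ι × ι => A p.1 ∩ A p.2) hAA,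
      Finset.sum_product]
  have hi2 : Integrable (fun x => Z n x ^ 2) μ := by
    simp only [hsq]
    exact integrable_sum_indicator_one (A := fun p : ι × ι => A p.1 ∩ A p.2) hAA _
  have hKS : 0 < K * S := mul_pos hK0 hSpos
  have hpt : ∀ x, Z n x ≤
      k + (B k)ᶜ.indicator (fun _ => K * S / 2) x + Z n x ^ 2 / (2 * (K * S)) := by
    intro x
    have h2 : 0 ≤ Z n x ^ 2 / (2 * (K * S)) := by positivity
    by_cases hx : x ∈ B k
    · rw [Set.indicator_of_notMem (by simpa using hx)]
      linarith [hx n]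
    · rw [Set.indicator_of_mem (by simpa using hx)]
      have : Z n x ≤ K * S / 2 + Z n x ^ 2 / (2 * (K * S)) := by
        have e : K * S / 2 + Z n x ^ 2 / (2 * (K * S)) - Z n x =
          (K * S - Z n x) ^ 2 / (2 * (K * S)) := by field_simp; ring
        have : 0 ≤ (K * S - Z n x) ^ 2 / (2 * (K * S)) := by positivity
        linarith
      have : (0 : ℝ) ≤ k := Nat.cast_nonneg k
      linarith
  have hi1 : Integrable ((B k)ᶜ.indicator fun _ => K * S / 2) μ :=
    (integrable_const _).indicator (hBm k).compl
  have hi0 : Integrable (fun _ : Ω => (k : ℝ)) μ := integrable_const _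
  have hle := integral_mono (integrable_sum_indicator_one hA (F n))
    ((hi0.add hi1).add (hi2.div_const (2 * (K * S)))) hpt
  rw [integral_sum_indicator_one hA, integral_add' (hi0.add hi1) (hi2.div_const _),
    integral_add' hi0 hi1, integral_div, hint2, integral_indicator_const _ (hBm k).compl,
    integral_const, smul_eq_mul, smul_eq_mul, ← hS] at hle
  have hb : μ.real (B k)ᶜ * (K * S / 2) ≤ S / 4 := by
    have := mul_le_mul_of_nonneg_right hk.le (by positivity : 0 ≤ K * S / 2)
    refine this.trans_eq ?_
    field_simp
    ring
  have hc : (∑ i ∈ F n, ∑ j ∈ F n, μ.real (A i ∩ A j)) / (2 * (K * S)) ≤ S / 2 := by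
    rw [div_le_iff₀ (by positivity)]
    refine hnK.trans_eq ?_
    ring
  linarith

end SecondMoment

section Densities

variable {Y G : Type*} [MetricSpace Y] [Group G] [MulAction G Y] {o : Y}

theorem IsHoroPoint.sub_le_dist {ξ : C(Y, ℝ)} (hξ : IsHoroPoint o ξ) (x y : Y) :
    ξ x - ξ y ≤ dist x y := by
  have hcl : IsClosed {η : C(Y, ℝ) | η x - η y ≤ dist x y} :=
    isClosed_le (by fun_prop) continuous_const
  refine closure_minimal ?_ hcl hξ.1
  rintro _ ⟨z, rfl⟩
  have := dist_triangle x y z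
  simp only [busemannCM, ContinuousMap.coe_mk, mem_ofPred_eq]
  linarith

theorem le_sub_of_mem_usualShadow {x y : Y} {r : ℝ} {ξ : C(Y, ℝ)}
    (hξ : ξ ∈ usualShadow o x y r) : dist x y - 2 * r - dist o x ≤ ξ o - ξ y := by
  obtain ⟨-, u, hu, hlim⟩ := hξ
  have hcl : IsClosed {η : C(Y, ℝ) | dist x y - 2 * r - dist o x ≤ η o - η y} :=
    isClosed_le continuous_const (by fun_prop)
  refine hcl.mem_of_tendsto hlim (Eventually.of_forall fun n => ?_)
  obtain ⟨γ, hγ, p, hp, hpy⟩ := hu n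
  have h1 := hγ.dist_add_dist hp
  have h2 := dist_triangle x p y
  have h3 := dist_triangle y p (u n)
  have h4 := dist_triangle x o (u n)
  rw [dist_comm y p] at h3
  rw [dist_comm x o] at h4
  simp only [busemannCM, ContinuousMap.coe_mk, mem_ofPred_eq]
  linarith

variable [ContinuousConstSMul G Y]

theorem continuous_horoAct (g : G) : Continuous (horoAct (Y := Y) o g) := by
  let s : C(Y, Y) := ⟨fun y => g⁻¹ • y, continuous_const_smul g⁻¹⟩
  have : horoAct (Y := Y) o g =
      fun ξ => ξ.comp s - ContinuousMap.const Y (ξ (g⁻¹ • o)) := by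
    ext ξ y
    rfl
  rw [this]
  exact (ContinuousMap.continuous_precomp s).sub
    (ContinuousMap.continuous_const'.comp (by fun_prop))

variable [MeasurableSpace C(Y, ℝ)]

/-- A conformal density on the horofunction boundary of arbitrary total mass. -/
structure IsFiniteDensity (G : Type*) {Y : Type*} [MetricSpace Y] [Group G] [MulAction G Y]
    [ContinuousConstSMul G Y] [MeasurableSpace C(Y, ℝ)] (o : Y) (ω : ℝ)
    (ν : Y → Measure C(Y, ℝ)) : Prop where
  finite : ∀ x, IsFiniteMeasure (ν x)
  ae_isHoroPoint : ∀ x, ∀ᵐ ξ ∂ν x, IsHoroPoint o ξ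
  map_eq : ∀ (g : G) (x : Y), (ν x).map (horoAct o g) = ν (g • x)
  eq_withDensity : ∀ x y : Y, ν x = (ν y).withDensity fun ξ : C(Y, ℝ) =>
    ENNReal.ofReal (Real.exp (-ω * (ξ x - ξ y)))

theorem IsConformalDensity.isFiniteDensity {ω : ℝ} {μ : Y → Measure C(Y, ℝ)}
    (hμ : IsConformalDensity G o ω μ) : IsFiniteDensity G o ω μ :=
  ⟨hμ.1, fun x => ae_iff.2 (hμ.2.1 x), hμ.2.2.2.1, hμ.2.2.2.2⟩

namespace IsFiniteDensity

variable {ω : ℝ} {ν : Y → Measure C(Y, ℝ)}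

theorem restrict [BorelSpace C(Y, ℝ)] (hν : IsFiniteDensity G o ω ν) {E : Set C(Y, ℝ)}
    (hE : MeasurableSet E) (hinv : ∀ g : G, horoAct o g ⁻¹' E = E) :
    IsFiniteDensity G o ω fun x => (ν x).restrict E where
  finite x := have := hν.finite x; inferInstance
  ae_isHoroPoint x := ae_restrict_of_ae (hν.ae_isHoroPoint x)
  map_eq g x := by
    rw [← hν.map_eq g x, Measure.restrict_map (continuous_horoAct g).measurable hE, hinv]
  eq_withDensity x y := by
    rw [hν.eq_withDensity x y, restrict_withDensity hE]

theorem measure_le (hν : IsFiniteDensity G o ω ν) (hω : 0 ≤ ω) (x y : Y) {a : ℝ}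
    {A : Set C(Y, ℝ)} (hA : ∀ ξ ∈ A, IsHoroPoint o ξ → a ≤ ξ x - ξ y) :
    ν x A ≤ ENNReal.ofReal (Real.exp (-ω * a)) * ν y A := by
  have := hν.finite y
  rw [hν.eq_withDensity x y, withDensity_apply', ← setLIntegral_const]
  refine setLIntegral_mono_ae aemeasurable_const ?_
  filter_upwards [hν.ae_isHoroPoint y] with ξ hξ hmem
  refine ENNReal.ofReal_le_ofReal (Real.exp_le_exp.2 ?_)
  have := mul_le_mul_of_nonneg_left (hA ξ hmem hξ) hω
  linarith

theorem real_le (hν : IsFiniteDensity G o ω ν) (hω : 0 ≤ ω) (x y : Y) {a : ℝ}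
    {A : Set C(Y, ℝ)} (hA : ∀ ξ ∈ A, IsHoroPoint o ξ → a ≤ ξ x - ξ y) :
    (ν x).real A ≤ Real.exp (-ω * a) * (ν y).real A := by
  have := hν.finite y
  have h := ENNReal.toReal_mono (ENNReal.mul_ne_top ENNReal.ofReal_ne_top (measure_ne_top _ _))
    (hν.measure_le hω x y hA)
  rwa [ENNReal.toReal_mul, ENNReal.toReal_ofReal (Real.exp_pos _).le] at h

theorem measure_smul [BorelSpace C(Y, ℝ)] (hν : IsFiniteDensity G o ω ν) (g : G) (x : Y)
    {A : Set C(Y, ℝ)} (hA : MeasurableSet A) : ν (g • x) A = ν x (horoAct o g ⁻¹' A) := by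
  rw [← hν.map_eq g x, Measure.map_apply (continuous_horoAct g).measurable hA]

theorem absolutelyContinuous (hν : IsFiniteDensity G o ω ν) (x y : Y) : ν x ≪ ν y := by
  rw [hν.eq_withDensity x y]
  exact withDensity_absolutelyContinuous _ _

end IsFiniteDensity

end Densities

section ShadowEstimates

variable {Y G : Type*} [MetricSpace Y] [Group G] [MulAction G Y]

/-- A proper isometric action on a geodesic space with a contracting element `f`. -/
structure IsContractingSetup (o : Y) (C : ℝ) (f : G) : Prop where
  geodesic : GeodesicSpace Y
  isometric : IsometricAction G Y
  proper : ProperAction G Y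
  nonneg : 0 ≤ C
  elt : IsContractingElt o C f

/-- The general term of the Poincaré series at the exponent `ω`. -/
def poincareTerm (o : Y) (ω : ℝ) (g : G) : ℝ :=
  Real.exp (-ω * dist o (g • o))

theorem poincareTerm_pos (o : Y) (ω : ℝ) (g : G) : 0 < poincareTerm o ω g :=
  Real.exp_pos _

theorem ProperAction.finite_dist_le (h : ProperAction G Y) (o : Y) (R : ℝ) :
    {g : G | dist o (g • o) ≤ R}.Finite := by
  refine (h (Metric.closedBall o R) Metric.isBounded_closedBall).subset fun g hg => ?_
  have hg : dist o (g • o) ≤ R := hg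
  have hR : 0 ≤ R := dist_nonneg.trans hg
  exact Set.Nonempty.ne_empty ⟨g • o, Set.smul_mem_smul_set (Metric.mem_closedBall_self hR),
    by rwa [Metric.mem_closedBall, dist_comm]⟩

/-- The finite set of elements moving `o` by at most `R`. -/
def ballFinset (h : ProperAction G Y) (o : Y) (R : ℝ) : Finset G :=
  (h.finite_dist_le o R).toFinset

theorem mem_ballFinset {h : ProperAction G Y} {o : Y} {R : ℝ} {g : G} :
    g ∈ ballFinset h o R ↔ dist o (g • o) ≤ R := by
  simp [ballFinset]

theorem ballFinset_mono (h : ProperAction G Y) (o : Y) : Monotone (ballFinset h o) := by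
  intro R S hRS g hg
  exact mem_ballFinset.2 ((mem_ballFinset.1 hg).trans hRS)

open Classical in
/-- The minimal representatives moving `o` by at most `R`. -/
def minFinset (h : ProperAction G Y) (o : Y) (f : G) (R : ℝ) : Finset G :=
  (ballFinset h o R).filter (· ∈ minReps o f)

theorem mem_minFinset {h : ProperAction G Y} {o : Y} {f : G} {R : ℝ} {g : G} :
    g ∈ minFinset h o f R ↔ dist o (g • o) ≤ R ∧ g ∈ minReps o f := by
  simp [minFinset, mem_ballFinset]

variable {o : Y} {C : ℝ} {f : G} {ω : ℝ}

theorem IsContractingSetup.exists_sum_ball_le (H : IsContractingSetup o C f) (hω : 0 < ω) :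
    ∃ K : ℝ, 0 < K ∧ ∀ R, ∑ g ∈ ballFinset H.proper o R, poincareTerm o ω g ≤
      K * ∑ g ∈ minFinset H.proper o f R, poincareTerm o ω g := by
  classical
  have hs := H.elt.summable_exp hω
  set Z := ∑' n : ℤ, Real.exp (-ω * dist o (f ^ n • o)) with hZ
  have hZ0 : 0 ≤ Z := tsum_nonneg fun _ => (Real.exp_pos _).le
  refine ⟨Real.exp (4 * C * ω) * (Z + 1), by positivity, fun R => ?_⟩
  choose t ht n hn using fun g : G => H.elt.exists_mem_minReps H.isometric g
  have htR : ∀ g, dist o (t g • o) ≤ dist o (g • o) := fun g => by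
    have := ht g (n g)
    rwa [← hn g] at this
  have hterm : ∀ g, poincareTerm o ω g ≤ Real.exp (4 * C * ω) *
      (poincareTerm o ω (t g) * Real.exp (-ω * dist o (f ^ n g • o))) := by
    intro g
    have := dist_add_dist_le_of_mem_minReps H.elt H.nonneg H.geodesic H.isometric (ht g) (n g)
    rw [← hn g] at this
    rw [poincareTerm, poincareTerm, ← Real.exp_add, ← Real.exp_add]
    refine Real.exp_le_exp.2 ?_
    have := mul_le_mul_of_nonneg_left this hω.le
    linarith
  set B := ballFinset H.proper o R
  have hinj : Set.InjOn (fun g => (t g, n g)) B := by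
    intro g _ h _ hgh
    simp only [Prod.mk.injEq] at hgh
    rw [hn g, hn h, hgh.1, hgh.2]
  have hmem : B.image (fun g => (t g, n g)) ⊆ minFinset H.proper o f R ×ˢ B.image n := by
    intro p hp
    obtain ⟨g, hg, rfl⟩ := Finset.mem_image.1 hp
    exact Finset.mem_product.2 ⟨mem_minFinset.2 ⟨(htR g).trans (mem_ballFinset.1 hg), ht g⟩,
      Finset.mem_image_of_mem n hg⟩
  calc ∑ g ∈ B, poincareTerm o ω g
      ≤ ∑ g ∈ B, Real.exp (4 * C * ω) *
        (poincareTerm o ω (t g) * Real.exp (-ω * dist o (f ^ n g • o))) :=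
        Finset.sum_le_sum fun g _ => hterm g
    _ = Real.exp (4 * C * ω) * ∑ p ∈ B.image (fun g => (t g, n g)),
        poincareTerm o ω p.1 * Real.exp (-ω * dist o (f ^ p.2 • o)) := by
        rw [← Finset.mul_sum, Finset.sum_image hinj]
    _ ≤ Real.exp (4 * C * ω) * ∑ p ∈ minFinset H.proper o f R ×ˢ B.image n,
        poincareTerm o ω p.1 * Real.exp (-ω * dist o (f ^ p.2 • o)) := by
        refine mul_le_mul_of_nonneg_left (Finset.sum_le_sum_of_subset_of_nonneg hmem
          fun p _ _ => ?_) (Real.exp_pos _).le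
        exact mul_nonneg (poincareTerm_pos _ _ _).le (Real.exp_pos _).le
    _ = Real.exp (4 * C * ω) * ((∑ g ∈ minFinset H.proper o f R, poincareTerm o ω g) *
        ∑ k ∈ B.image n, Real.exp (-ω * dist o (f ^ k • o))) := by
        rw [Finset.sum_mul_sum, Finset.sum_product]
    _ ≤ Real.exp (4 * C * ω) * ((∑ g ∈ minFinset H.proper o f R, poincareTerm o ω g) *
        (Z + 1)) := by
        have h1 : ∑ k ∈ B.image n, Real.exp (-ω * dist o (f ^ k • o)) ≤ Z :=
          hs.sum_le_tsum _ fun _ _ => (Real.exp_pos _).le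
        have h2 : 0 ≤ ∑ g ∈ minFinset H.proper o f R, poincareTerm o ω g :=
          Finset.sum_nonneg fun _ _ => (poincareTerm_pos _ _ _).le
        gcongr
        linarith
    _ = _ := by ring

open Classical in
/-- Only boundedly many sets attached to minimal representatives of comparable length
contain a given boundary point. -/
theorem IsContractingSetup.card_filter_le [ProperSpace Y] (H : IsContractingSetup o C f)
    {A : Finset G} {a L : ℝ}
    (hA : ∀ g ∈ A, g ∈ minReps o f ∧ a ≤ dist o (g • o) ∧ dist o (g • o) ≤ a + L)
    {ξ : C(Y, ℝ)} (hξ : IsHoroPoint o ξ) :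
    (A.filter fun g => ξ ∈ escapeSet o f C g).card ≤
      (ballFinset H.proper o (L + 16 * C)).card := by
  rcases (A.filter fun g => ξ ∈ escapeSet o f C g).eq_empty_or_nonempty with he | hne
  · simp [he]
  obtain ⟨g, hg, hmin⟩ := Finset.exists_min_image _ (fun g : G => dist o (g • o)) hne
  rw [Finset.mem_filter] at hg
  refine Finset.card_le_card_of_injOn (fun h => g⁻¹ * h) (fun h hh => ?_)
    (fun _ _ _ _ e => mul_left_cancel e)
  have hle := hmin h hh
  rw [Finset.mem_coe, Finset.mem_filter] at hh
  have := H.elt.dist_add_dist_le_of_mem_escapeSet H.nonneg H.geodesic H.isometric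
    (hA g hg.1).1 (hA h hh.1).1 hξ hg.2 hh.2 hle
  have h1 := (hA g hg.1).2.1
  have h2 := (hA h hh.1).2.2
  exact mem_ballFinset.2 (by linarith)

variable [MeasurableSpace C(Y, ℝ)] [BorelSpace C(Y, ℝ)]

theorem IsContractingSetup.measurableSet_escapeSet (H : IsContractingSetup o C f) (g : G) :
    MeasurableSet (escapeSet o f C g) :=
  (H.elt.isOpen_escapeSet g).measurableSet

variable [ContinuousConstSMul G Y] {ν : Y → Measure C(Y, ℝ)}

theorem IsFiniteDensity.real_smul_univ (hν : IsFiniteDensity G o ω ν) (g : G) :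
    (ν (g • o)).real Set.univ = (ν o).real Set.univ := by
  rw [measureReal_def, hν.measure_smul _ _ MeasurableSet.univ, Set.preimage_univ,
    measureReal_def]

theorem IsFiniteDensity.real_usualShadow_le (hν : IsFiniteDensity G o ω ν) (hω : 0 ≤ ω)
    (x : Y) (g : G) (r : ℝ) {A : Set C(Y, ℝ)}
    (hA : ∀ ξ ∈ A, IsHoroPoint o ξ → ξ ∈ usualShadow o x (g • o) r) :
    (ν o).real A ≤ Real.exp (ω * (2 * r + 2 * dist o x)) * (ν o).real Set.univ *
      poincareTerm o ω g := by
  have := hν.finite (g • o)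
  have h := hν.real_le hω o (g • o) (a := dist o (g • o) - 2 * r - 2 * dist o x) (A := A)
    fun ξ hξ hh => by
      have h1 := le_sub_of_mem_usualShadow (hA ξ hξ hh)
      have h2 := dist_triangle o x (g • o)
      linarith
  have h2 : (ν (g • o)).real A ≤ (ν o).real Set.univ :=
    (measureReal_mono (Set.subset_univ A)).trans_eq (hν.real_smul_univ g)
  refine (h.trans (mul_le_mul_of_nonneg_left h2 (Real.exp_pos _).le)).trans_eq ?_
  rw [poincareTerm, mul_right_comm, ← Real.exp_add]
  congr 2
  ring

theorem IsContractingSetup.escapeSet_one_pos (H : IsContractingSetup o C f)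
    (hν : IsFiniteDensity G o ω ν) (h0 : ν o Set.univ ≠ 0) :
    0 < (ν o).real (escapeSet o f C 1) := by
  have := hν.finite o
  rw [measureReal_def, ENNReal.toReal_pos_iff]
  refine ⟨pos_iff_ne_zero.2 fun hz => h0 ?_, measure_lt_top _ _⟩
  obtain ⟨N, hN⟩ := H.elt.exists_lt_dist (6 * C)
  have h1 : ν (f ^ N • o) (escapeSet o f C (f ^ N)) = 0 := by
    rw [hν.measure_smul _ _ (H.measurableSet_escapeSet _)]
    convert hz
    ext ξ
    rw [Set.mem_preimage, horoAct_mem_escapeSet, inv_mul_cancel]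
  have h2 := hν.absolutelyContinuous o (f ^ N • o) h1
  refine measure_mono_null (fun ξ _ => ?_) (measure_union_null hz h2)
  exact mem_escapeSet_or H.isometric hN ξ

theorem IsContractingSetup.le_real_escapeSet (H : IsContractingSetup o C f)
    (hν : IsFiniteDensity G o ω ν) (hω : 0 ≤ ω) (g : G) :
    (ν o).real (escapeSet o f C 1) * poincareTerm o ω g ≤ (ν o).real (escapeSet o f C g) := by
  have h1 : (ν (g • o)).real (escapeSet o f C g) = (ν o).real (escapeSet o f C 1) := by
    rw [measureReal_def, hν.measure_smul _ _ (H.measurableSet_escapeSet _), measureReal_def]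
    congr 2
    ext ξ
    rw [Set.mem_preimage, horoAct_mem_escapeSet, inv_mul_cancel]
  have h2 := hν.real_le hω (g • o) o (a := -dist o (g • o)) (A := escapeSet o f C g)
    fun ξ _ hξ => by linarith [hξ.sub_le_dist o (g • o)]
  rw [h1] at h2
  have h3 := mul_le_mul_of_nonneg_right h2 (poincareTerm_pos o ω g).le
  refine h3.trans_eq ?_
  rw [poincareTerm, mul_right_comm, ← Real.exp_add]
  simp

variable [ProperSpace Y]

theorem IsContractingSetup.real_escapeSet_le (H : IsContractingSetup o C f)
    (hν : IsFiniteDensity G o ω ν) (hω : 0 ≤ ω) {g : G} (hg : g ∈ minReps o f) :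
    (ν o).real (escapeSet o f C g) ≤
      Real.exp (ω * (4 * C)) * (ν o).real Set.univ * poincareTerm o ω g := by
  have h := hν.real_usualShadow_le hω ((1 : G) • o) g (2 * C)
    (A := escapeSet o f C g) fun ξ hξ hh => by
      have := H.elt.mem_usualShadow H.nonneg H.geodesic H.isometric (k := 1) hg hh
        (by rwa [one_mul])
      rwa [one_mul] at this
  rw [one_smul, dist_self] at h
  refine h.trans_eq ?_
  congr 3
  ring

theorem IsContractingSetup.sum_annulus_le (H : IsContractingSetup o C f)
    (hν : IsFiniteDensity G o ω ν) (hω : 0 ≤ ω) (h0 : ν o Set.univ ≠ 0) {A : Finset G} {a L : ℝ}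
    (hA : ∀ g ∈ A, g ∈ minReps o f ∧ a ≤ dist o (g • o) ∧ dist o (g • o) ≤ a + L) :
    ∑ g ∈ A, poincareTerm o ω g ≤ (ballFinset H.proper o (L + 16 * C)).card *
      (ν o).real Set.univ / (ν o).real (escapeSet o f C 1) := by
  classical
  have := hν.finite o
  rw [le_div_iff₀ (H.escapeSet_one_pos hν h0), mul_comm, Finset.mul_sum]
  refine (Finset.sum_le_sum fun g _ => H.le_real_escapeSet hν hω g).trans ?_
  refine sum_measureReal_le_of_card_le H.measurableSet_escapeSet A ?_
  filter_upwards [hν.ae_isHoroPoint o] with ξ hξ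
  exact_mod_cast H.card_filter_le hA hξ

theorem IsContractingSetup.sum_minFinset_add_le (H : IsContractingSetup o C f)
    (hν : IsFiniteDensity G o ω ν) (hω : 0 ≤ ω) (h0 : ν o Set.univ ≠ 0) (R : ℝ) {L : ℝ}
    (hL : 0 ≤ L) :
    ∑ g ∈ minFinset H.proper o f (R + L), poincareTerm o ω g ≤
      ∑ g ∈ minFinset H.proper o f R, poincareTerm o ω g +
      (ballFinset H.proper o (L + 16 * C)).card *
        (ν o).real Set.univ / (ν o).real (escapeSet o f C 1) := by
  classical
  have hsub : minFinset H.proper o f R ⊆ minFinset H.proper o f (R + L) := fun g hg =>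
    mem_minFinset.2 ⟨(mem_minFinset.1 hg).1.trans (by linarith), (mem_minFinset.1 hg).2⟩
  rw [← Finset.sum_sdiff hsub, add_comm]
  refine add_le_add_right (H.sum_annulus_le hν hω h0 (a := R) fun g hg => ?_) _
  rw [Finset.mem_sdiff, mem_minFinset, mem_minFinset] at hg
  refine ⟨hg.1.2, ?_, hg.1.1⟩
  by_contra! hlt
  exact hg.2 ⟨hlt.le, hg.1.2⟩

/-- Quasi-independence of the sets attached to the minimal representatives. -/
theorem IsContractingSetup.sum_inter_le (H : IsContractingSetup o C f)
    (hν : IsFiniteDensity G o ω ν) (hω : 0 ≤ ω) (R : ℝ) :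
    ∑ g ∈ minFinset H.proper o f R, ∑ h ∈ minFinset H.proper o f R,
      (ν o).real (escapeSet o f C g ∩ escapeSet o f C h) ≤
    2 * (Real.exp (ω * (20 * C)) * (ν o).real Set.univ) *
      ((∑ g ∈ minFinset H.proper o f R, poincareTerm o ω g) *
        ∑ k ∈ ballFinset H.proper o (R + 16 * C), poincareTerm o ω k) := by
  classical
  have := hν.finite o
  set T := minFinset H.proper o f R with hT
  set B := ballFinset H.proper o (R + 16 * C) with hB
  set D := Real.exp (ω * (20 * C)) * (ν o).real Set.univ with hD
  have hD0 : 0 ≤ D := by positivity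
  let F : G → G → ℝ := fun g h =>
    if g⁻¹ * h ∈ B then D * (poincareTerm o ω g * poincareTerm o ω (g⁻¹ * h)) else 0
  have hF0 : ∀ g h, 0 ≤ F g h := by
    intro g h
    simp only [F]
    split_ifs
    · have := poincareTerm_pos o ω g
      have := poincareTerm_pos o ω (g⁻¹ * h)
      positivity
    · exact le_rfl
  have key : ∀ g ∈ T, ∀ h ∈ T, dist o (g • o) ≤ dist o (h • o) →
      (ν o).real (escapeSet o f C g ∩ escapeSet o f C h) ≤ F g h := by
    intro g hg h hh hle
    rw [hT, mem_minFinset] at hg hh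
    by_cases hex : ∃ ξ ∈ escapeSet o f C g ∩ escapeSet o f C h, IsHoroPoint o ξ
    · obtain ⟨ξ, hξ, hhoro⟩ := hex
      have hd := H.elt.dist_add_dist_le_of_mem_escapeSet H.nonneg H.geodesic H.isometric
        hg.2 hh.2 hhoro hξ.1 hξ.2 hle
      have hmem : g⁻¹ * h ∈ B := by
        rw [hB, mem_ballFinset]
        linarith [dist_nonneg (x := o) (y := g • o)]
      simp only [F, if_pos hmem]
      refine (measureReal_mono Set.inter_subset_right).trans
        ((H.real_escapeSet_le hν hω hh.2).trans ?_)
      rw [hD, mul_right_comm, mul_right_comm (Real.exp (ω * (20 * C)))]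
      refine mul_le_mul_of_nonneg_right ?_ measureReal_nonneg
      simp only [poincareTerm, ← Real.exp_add]
      refine Real.exp_le_exp.2 ?_
      have := mul_le_mul_of_nonneg_left hd hω
      linarith
    · push Not at hex
      have : (ν o) (escapeSet o f C g ∩ escapeSet o f C h) = 0 :=
        measure_mono_null (fun ξ hξ => hex ξ hξ) (ae_iff.1 (hν.ae_isHoroPoint o))
      rw [measureReal_def, this, ENNReal.toReal_zero]
      exact hF0 g h
  have hsum : ∑ g ∈ T, ∑ h ∈ T, F g h ≤
      D * ((∑ g ∈ T, poincareTerm o ω g) * ∑ k ∈ B, poincareTerm o ω k) := by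
    rw [Finset.sum_mul, Finset.mul_sum]
    refine Finset.sum_le_sum fun g _ => ?_
    rw [← Finset.sum_filter, ← Finset.mul_sum, ← Finset.mul_sum]
    refine mul_le_mul_of_nonneg_left (mul_le_mul_of_nonneg_left ?_ (poincareTerm_pos _ _ _).le) hD0
    rw [← Finset.sum_image (s := T.filter fun h => g⁻¹ * h ∈ B) (g := fun h => g⁻¹ * h)
      (f := poincareTerm o ω) (fun _ _ _ _ e => mul_left_cancel e)]
    refine Finset.sum_le_sum_of_subset_of_nonneg (fun k hk => ?_)
      fun _ _ _ => (poincareTerm_pos _ _ _).le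
    obtain ⟨h, hh, rfl⟩ := Finset.mem_image.1 hk
    exact (Finset.mem_filter.1 hh).2
  calc ∑ g ∈ T, ∑ h ∈ T, (ν o).real (escapeSet o f C g ∩ escapeSet o f C h)
      ≤ ∑ g ∈ T, ∑ h ∈ T, (F g h + F h g) := by
        refine Finset.sum_le_sum fun g hg => Finset.sum_le_sum fun h hh => ?_
        rcases le_total (dist o (g • o)) (dist o (h • o)) with hle | hle
        · linarith [key g hg h hh hle, hF0 h g]
        · rw [Set.inter_comm]
          linarith [key h hh g hg hle, hF0 g h]
    _ = 2 * ∑ g ∈ T, ∑ h ∈ T, F g h := by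
        simp only [Finset.sum_add_distrib]
        rw [Finset.sum_comm (f := fun g h => F h g), two_mul]
    _ ≤ _ := by
        rw [mul_assoc 2 D]
        exact mul_le_mul_of_nonneg_left hsum two_pos.le

end ShadowEstimates

section Divergence

variable {Y G : Type*} [MetricSpace Y] [Group G] [MulAction G Y] {o : Y} {ω : ℝ}

theorem ProperAction.summable_of_sum_ball_le (h : ProperAction G Y) {c : ℝ}
    (hc : ∀ n : ℕ, ∑ g ∈ ballFinset h o n, poincareTerm o ω g ≤ c) :
    Summable fun g : G => poincareTerm o ω g := by
  classical
  refine summable_of_sum_le (fun g => (poincareTerm_pos o ω g).le) (c := c) fun u => ?_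
  obtain ⟨M, hM⟩ := (u.image fun g => dist o (g • o)).exists_le
  obtain ⟨n, hn⟩ := exists_nat_ge M
  refine le_trans ?_ (hc n)
  exact Finset.sum_le_sum_of_subset_of_nonneg
    (fun g hg => mem_ballFinset.2 ((hM _ (Finset.mem_image_of_mem _ hg)).trans hn))
    fun g _ _ => (poincareTerm_pos o ω g).le

theorem ProperAction.sum_ball_mono (h : ProperAction G Y) (o : Y) (ω : ℝ) :
    Monotone fun R => ∑ g ∈ ballFinset h o R, poincareTerm o ω g := fun _ _ hRS =>
  Finset.sum_le_sum_of_subset_of_nonneg (ballFinset_mono h o hRS)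
    fun g _ _ => (poincareTerm_pos o ω g).le

theorem ProperAction.tendsto_sum_ball (h : ProperAction G Y)
    (hdiv : ¬ Summable fun g : G => poincareTerm o ω g) :
    Tendsto (fun n : ℕ => ∑ g ∈ ballFinset h o n, poincareTerm o ω g) atTop atTop := by
  refine tendsto_atTop_atTop_of_monotone
    (fun m n hmn => h.sum_ball_mono o ω (Nat.cast_le.2 hmn)) fun b => ?_
  by_contra! hb
  exact hdiv (h.summable_of_sum_ball_le fun n => (hb n).le)

theorem ProperAction.summable_of_card_le (h : ProperAction G Y) {s : ℝ} (hω : 0 ≤ ω) (hs : s < ω)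
    (hcard : ∀ᶠ n : ℕ in atTop, ((ballFinset h o n).card : ℝ) ≤ Real.exp (s * n)) :
    Summable fun g : G => poincareTerm o ω g := by
  classical
  obtain ⟨n₀, hn₀⟩ := eventually_atTop.1 hcard
  set t : ℕ → ℝ := fun n => Real.exp s * Real.exp (s - ω) ^ n
  have ht : Summable t := (summable_geometric_of_lt_one (Real.exp_pos _).le
    (Real.exp_lt_one_iff.2 (by linarith))).mul_left _
  have ht0 : ∀ n, 0 ≤ t n := fun n => by positivity
  set S : ℕ → ℝ := fun n => ∑ g ∈ ballFinset h o n, poincareTerm o ω g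
  have hmono : Monotone S := fun m n hmn => h.sum_ball_mono o ω (Nat.cast_le.2 hmn)
  have hstep : ∀ n, n₀ ≤ n → S (n + 1) ≤ S n + t n := by
    intro n hn
    have hsub : ballFinset h o n ⊆ ballFinset h o ((n + 1 : ℕ) : ℝ) :=
      ballFinset_mono h o (Nat.cast_le.2 n.le_succ)
    simp only [S]
    rw [← Finset.sum_sdiff hsub, add_comm]
    refine add_le_add_right ?_ _
    calc ∑ g ∈ ballFinset h o ((n + 1 : ℕ) : ℝ) \ ballFinset h o n, poincareTerm o ω g
        ≤ (ballFinset h o ((n + 1 : ℕ) : ℝ) \ ballFinset h o n).card • Real.exp (-ω * n) := by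
          refine Finset.sum_le_card_nsmul _ _ _ fun g hg => ?_
          rw [Finset.mem_sdiff, mem_ballFinset, mem_ballFinset, not_le] at hg
          refine Real.exp_le_exp.2 ?_
          have := mul_le_mul_of_nonneg_left hg.2.le hω
          linarith
      _ ≤ Real.exp (s * (n + 1 : ℕ)) * Real.exp (-ω * n) := by
          rw [nsmul_eq_mul]
          refine mul_le_mul_of_nonneg_right (le_trans ?_ (hn₀ (n + 1) (by omega)))
            (Real.exp_pos _).le
          exact_mod_cast Finset.card_le_card Finset.sdiff_subset
      _ = t n := by
          simp only [t]
          rw [← Real.exp_nat_mul, ← Real.exp_add, ← Real.exp_add]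
          congr 1
          push_cast
          ring
  have hbound : ∀ n, n₀ ≤ n → S n ≤ S n₀ + ∑ k ∈ Finset.range n, t k := by
    intro n hn
    induction n, hn using Nat.le_induction with
    | base => linarith [Finset.sum_nonneg fun k (_ : k ∈ Finset.range n₀) => ht0 k]
    | succ n hn ih =>
      rw [Finset.sum_range_succ]
      linarith [hstep n hn]
  refine h.summable_of_sum_ball_le (c := S n₀ + ∑' k, t k) fun n => ?_
  refine (hmono (le_max_left n n₀)).trans ((hbound _ (le_max_right n n₀)).trans ?_)
  linarith [ht.sum_le_tsum (Finset.range (max n n₀)) fun k _ => ht0 k]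

theorem ProperAction.orbitCount_univ (h : ProperAction G Y) (o : Y) (R : ℝ) :
    orbitCount G o Set.univ R = (ballFinset h o R).card := by
  rw [orbitCount, ballFinset, ← Set.ncard_eq_toFinset_card _ (h.finite_dist_le o R)]
  simp only [Set.mem_univ, true_and, ← Nat.card_coe_set_eq, Set.coe_ofPred]

theorem ProperAction.one_le_card (h : ProperAction G Y) (o : Y) {R : ℝ} (hR : 0 ≤ R) :
    1 ≤ (ballFinset h o R).card :=
  Finset.card_pos.2 ⟨1, mem_ballFinset.2 (by simpa)⟩

/-- If the orbit grows like `exp (ω * R)` up to a linear factor and the Poincaré series diverges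
at `ω`, then `ω` is the critical exponent. -/
theorem ProperAction.eq_critExp (h : ProperAction G Y) (hω : 0 ≤ ω)
    (hdiv : ¬ Summable fun g : G => poincareTerm o ω g) {A : ℝ} (hA : 0 < A)
    (hcard : ∀ R : ℝ, 1 ≤ R → ((ballFinset h o R).card : ℝ) ≤ A * R * Real.exp (ω * R)) :
    ω = critExp G o (Set.univ : Set G) := by
  set v : ℝ → ℝ := fun R => Real.log (orbitCount G o (Set.univ : Set G) R) / R with hv
  set u : ℝ → ℝ := fun R => Real.log A / R + Real.log R / R + ω with hu
  have hlim : Tendsto u atTop (𝓝 ω) := by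
    have h1 : Tendsto (fun R : ℝ => Real.log A / R) atTop (𝓝 0) :=
      tendsto_const_nhds.div_atTop tendsto_id
    have h2 : Tendsto (fun R : ℝ => Real.log R / R) atTop (𝓝 0) :=
      Real.isLittleO_log_id_atTop.tendsto_div_nhds_zero
    simpa using (h1.add h2).add_const ω
  have hle : v ≤ᶠ[atTop] u := by
    filter_upwards [eventually_ge_atTop (1 : ℝ)] with R hR
    have hR0 : 0 < R := by linarith
    have hc : (0 : ℝ) < (ballFinset h o R).card := by exact_mod_cast h.one_le_card o hR0.le
    have := Real.log_le_log hc (hcard R hR)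
    rw [Real.log_mul (by positivity) (Real.exp_pos _).ne', Real.log_mul hA.ne' hR0.ne',
      Real.log_exp] at this
    simp only [hv, hu]
    rw [h.orbitCount_univ, div_le_iff₀ hR0]
    refine this.trans_eq ?_
    field_simp
  have hnonneg : ∀ᶠ R in atTop, 0 ≤ v R := by
    filter_upwards [eventually_ge_atTop (1 : ℝ)] with R hR
    exact div_nonneg (Real.log_natCast_nonneg _) (by linarith)
  have hbdd : IsBoundedUnder (· ≤ ·) atTop v := hlim.isBoundedUnder_le.mono_le hle
  refine le_antisymm ?_ ?_
  · by_contra! hlt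
    obtain ⟨s, hs1, hs2⟩ := exists_between hlt
    refine hdiv (h.summable_of_card_le hω hs2 ?_)
    have hev := eventually_lt_of_limsup_lt hs1 hbdd
    filter_upwards [tendsto_natCast_atTop_atTop.eventually hev, eventually_ge_atTop 1] with n hn hn1
    have hn0 : (0 : ℝ) < n := by exact_mod_cast hn1
    have hc : (0 : ℝ) < (ballFinset h o n).card := by exact_mod_cast h.one_le_card o hn0.le
    rw [h.orbitCount_univ, div_lt_iff₀ hn0] at hn
    exact ((Real.log_lt_iff_lt_exp hc).1 hn).le
  · rw [← hlim.limsup_eq]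
    exact limsup_le_limsup hle (isCoboundedUnder_le_of_eventually_le _ hnonneg)
      hlim.isBoundedUnder_le

variable [ProperSpace Y] [ContinuousConstSMul G Y] [MeasurableSpace C(Y, ℝ)] [BorelSpace C(Y, ℝ)]
  {ν : Y → Measure C(Y, ℝ)} {C : ℝ} {f : G}

theorem IsContractingSetup.exists_card_ball_le (H : IsContractingSetup o C f)
    (hν : IsFiniteDensity G o ω ν) (hω : 0 < ω) (h0 : ν o Set.univ ≠ 0) :
    ∃ A : ℝ, 0 < A ∧ ∀ R : ℝ, 1 ≤ R →
      ((ballFinset H.proper o R).card : ℝ) ≤ A * R * Real.exp (ω * R) := by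
  obtain ⟨K, hK, hball⟩ := H.exists_sum_ball_le hω
  set c : ℝ := (ballFinset H.proper o (1 + 16 * C)).card *
    (ν o).real Set.univ / (ν o).real (escapeSet o f C 1) with hc
  have hc0 : 0 ≤ c := by positivity
  set a : ℝ := ∑ g ∈ minFinset H.proper o f 0, poincareTerm o ω g with ha
  have ha0 : 0 ≤ a := Finset.sum_nonneg fun g _ => (poincareTerm_pos o ω g).le
  have hlin : ∀ n : ℕ, ∑ g ∈ minFinset H.proper o f n, poincareTerm o ω g ≤ a + c * n := by
    intro n
    induction n with
    | zero => simp [ha]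
    | succ n ih =>
      have := H.sum_minFinset_add_le hν hω.le h0 n zero_le_one
      push_cast
      linarith
  refine ⟨K * (a + 2 * c + 1), by positivity, fun R hR => ?_⟩
  have hceil : (⌈R⌉₊ : ℝ) ≤ 2 * R := by linarith [Nat.ceil_lt_add_one (zero_le_one.trans hR)]
  have h1 : ((ballFinset H.proper o R).card : ℝ) * Real.exp (-ω * R) ≤
      ∑ g ∈ ballFinset H.proper o R, poincareTerm o ω g := by
    rw [← nsmul_eq_mul]
    refine Finset.card_nsmul_le_sum _ _ _ fun g hg => Real.exp_le_exp.2 ?_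
    have := mul_le_mul_of_nonneg_left (mem_ballFinset.1 hg) hω.le
    linarith
  have h2 := H.proper.sum_ball_mono o ω (Nat.le_ceil R)
  have h3 : ((ballFinset H.proper o R).card : ℝ) * Real.exp (-ω * R) ≤
      K * (a + 2 * c + 1) * R := by
    refine h1.trans (h2.trans ((hball _).trans ?_))
    rw [mul_assoc]
    refine mul_le_mul_of_nonneg_left ((hlin _).trans ?_) hK.le
    nlinarith
  have h4 := mul_le_mul_of_nonneg_right h3 (Real.exp_pos (ω * R)).le
  rwa [mul_assoc, ← Real.exp_add, neg_mul, neg_add_cancel, Real.exp_zero, mul_one] at h4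

/-- If the Poincaré series diverges, then the points lying in infinitely many of the sets attached
to minimal representatives have positive measure. -/
theorem IsContractingSetup.measure_infinite_pos (H : IsContractingSetup o C f)
    (hν : IsFiniteDensity G o ω ν) (hω : 0 < ω) (h0 : ν o Set.univ ≠ 0)
    (hdiv : ¬ Summable fun g : G => poincareTerm o ω g) :
    0 < ν o {ξ | {g : G | g ∈ minReps o f ∧ ξ ∈ escapeSet o f C g}.Infinite} := by
  have := hν.finite o
  obtain ⟨K, hK, hball⟩ := H.exists_sum_ball_le hω
  set κ := (ν o).real (escapeSet o f C 1)
  have hκ : 0 < κ := H.escapeSet_one_pos hν h0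
  set D := 2 * (Real.exp (ω * (20 * C)) * (ν o).real Set.univ)
  have hD : 0 < D := by
    have : 0 < (ν o).real Set.univ := hκ.trans_le (measureReal_mono (Set.subset_univ _))
    positivity
  set c : ℝ := (ballFinset H.proper o (16 * C + 16 * C)).card * (ν o).real Set.univ / κ
  let A : G → Set C(Y, ℝ) := fun g => {ξ | g ∈ minReps o f ∧ ξ ∈ escapeSet o f C g}
  have hA : ∀ g ∈ minReps o f, A g = escapeSet o f C g := fun g hg => by
    ext ξ
    simp [A, hg]
  set F : ℕ → Finset G := fun n => minFinset H.proper o f n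
  set S : ℝ → ℝ := fun R => ∑ g ∈ minFinset H.proper o f R, poincareTerm o ω g
  have hS : Tendsto (fun n : ℕ => S n) atTop atTop := by
    refine (tendsto_const_mul_atTop_of_pos hK).1 ?_
    exact tendsto_atTop_mono (fun n => hball n) (H.proper.tendsto_sum_ball hdiv)
  have hAF : ∀ n, ∀ g ∈ F n, A g = escapeSet o f C g := fun n g hg => hA g (mem_minFinset.1 hg).2
  have hlow : ∀ n : ℕ, κ * S n ≤ ∑ g ∈ F n, (ν o).real (A g) := fun n => by
    simp only [S]
    rw [Finset.mul_sum]
    refine Finset.sum_le_sum fun g hg => ?_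
    rw [hAF n g hg]
    exact H.le_real_escapeSet hν hω.le g
  refine measure_infinite_pos_of_sum_inter_le (A := A) (K := D * (K * 2) / κ ^ 2)
    (fun g => (MeasurableSet.const _).inter (H.measurableSet_escapeSet g)) F (by positivity)
    (tendsto_atTop_mono hlow (hS.const_mul_atTop hκ)) ?_
  filter_upwards [hS.eventually_ge_atTop c, hS.eventually_ge_atTop 0] with n hn hn0
  have h1 : ∑ g ∈ F n, ∑ h ∈ F n, (ν o).real (A g ∩ A h) =
      ∑ g ∈ F n, ∑ h ∈ F n, (ν o).real (escapeSet o f C g ∩ escapeSet o f C h) :=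
    Finset.sum_congr rfl fun g hg => Finset.sum_congr rfl fun h hh => by
      rw [hAF n g hg, hAF n h hh]
  have h2 := H.sum_inter_le hν hω.le n
  have h3 := hball (n + 16 * C)
  have h4 : S (n + 16 * C) ≤ S n + c :=
    H.sum_minFinset_add_le hν hω.le h0 n (by linarith [H.nonneg])
  have h5 : ∑ k ∈ ballFinset H.proper o (n + 16 * C), poincareTerm o ω k ≤ K * (2 * S n) :=
    h3.trans (mul_le_mul_of_nonneg_left (by linarith) hK.le)
  rw [h1]
  calc _ ≤ D * (S n * ∑ k ∈ ballFinset H.proper o (n + 16 * C), poincareTerm o ω k) := h2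
    _ ≤ D * (S n * (K * (2 * S n))) := by gcongr
    _ = D * (K * 2) / κ ^ 2 * (κ * S n) ^ 2 := by
        field_simp
    _ ≤ _ := by
        have := hlow n
        gcongr

end Divergence

section ConicalSet

variable {Y G : Type*} [MetricSpace Y] [Group G] [MulAction G Y] {o : Y} {ω : ℝ} {C : ℝ} {f : G}

/-- The horofunctions lying in infinitely many sets attached to minimal representatives,
up to translation. -/
def recurrentSet (o : Y) (f : G) (C : ℝ) : Set C(Y, ℝ) :=
  {ξ | ∃ k : G, {g : G | g ∈ minReps o f ∧ ξ ∈ escapeSet o f C (k * g)}.Infinite}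

theorem usualShadow_mono {x y : Y} {r s : ℝ} (hrs : r ≤ s) :
    usualShadow o x y r ⊆ usualShadow o x y s := by
  rintro ξ ⟨hξ, u, hu, hlim⟩
  refine ⟨hξ, u, fun n => ?_, hlim⟩
  obtain ⟨γ, hγ, p, hp, hpy⟩ := hu n
  exact ⟨γ, hγ, p, hp, hpy.trans hrs⟩

theorem measurableSet_infinite {Ω ι : Type*} [MeasurableSpace Ω] [Countable ι] {A : ι → Set Ω}
    (hA : ∀ i, MeasurableSet (A i)) : MeasurableSet {x | {i | x ∈ A i}.Infinite} := by
  have : {x | {i | x ∈ A i}.Infinite} = ⋂ s : Finset ι, ⋃ i ∈ {i | i ∉ s}, A i := by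
    ext x
    simp only [mem_ofPred_eq, Set.mem_iInter, Set.mem_iUnion, exists_prop]
    refine ⟨fun h s => ?_, fun h hfin => ?_⟩
    · obtain ⟨i, hi, his⟩ := h.exists_notMem_finset s
      exact ⟨i, his, hi⟩
    · obtain ⟨i, his, hi⟩ := h hfin.toFinset
      exact his (hfin.mem_toFinset.2 hi)
  rw [this]
  exact MeasurableSet.iInter fun s => MeasurableSet.biUnion (Set.to_countable _) fun i _ => hA i

theorem IsContractingSetup.mem_conicalSet [ProperSpace Y] (H : IsContractingSetup o C f)
    (hC : 0 < C) {ξ : C(Y, ℝ)} (hξ : IsHoroPoint o ξ) (hmem : ξ ∈ recurrentSet o f C) :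
    ξ ∈ conicalSet G o := by
  obtain ⟨k, hk⟩ := hmem
  have hex : ∀ n : ℕ, ∃ g : G, (g ∈ minReps o f ∧ ξ ∈ escapeSet o f C (k * g)) ∧
      (n : ℝ) < dist o ((k * g) • o) := by
    intro n
    obtain ⟨g, hg, hgn⟩ := hk.exists_notMem_finset
      ((H.proper.finite_dist_le o n).preimage (mul_right_injective k).injOn).toFinset
    exact ⟨g, hg, by simpa using hgn⟩
  choose u hu hlt using hex
  refine ⟨2 * C, by linarith, k, fun n => k * u n,
    tendsto_atTop_mono (fun n => (hlt n).le) tendsto_natCast_atTop_atTop, fun n => ?_⟩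
  exact H.elt.mem_usualShadow H.nonneg H.geodesic H.isometric (hu n).1 hξ (hu n).2

theorem preimage_recurrentSet [ContinuousConstSMul G Y] (g : G) :
    horoAct o g ⁻¹' recurrentSet o f C = recurrentSet o f C := by
  ext ξ
  simp only [Set.mem_preimage, recurrentSet, mem_ofPred_eq, horoAct_mem_escapeSet, ← mul_assoc]
  exact ⟨fun ⟨k, hk⟩ => ⟨g⁻¹ * k, hk⟩, fun ⟨k, hk⟩ => ⟨g * k, by simpa using hk⟩⟩

variable [MeasurableSpace C(Y, ℝ)] [BorelSpace C(Y, ℝ)] [Countable G]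

theorem IsContractingSetup.measurableSet_recurrentSet (H : IsContractingSetup o C f) :
    MeasurableSet (recurrentSet o f C) := by
  have : recurrentSet o f C =
      ⋃ k : G, {ξ | {g : G | g ∈ minReps o f ∧ ξ ∈ escapeSet o f C (k * g)}.Infinite} := by
    ext ξ
    simp [recurrentSet]
  rw [this]
  exact MeasurableSet.iUnion fun k => measurableSet_infinite
    (A := fun g => {ξ | g ∈ minReps o f ∧ ξ ∈ escapeSet o f C (k * g)})
    fun g => (MeasurableSet.const _).inter (H.measurableSet_escapeSet _)

variable [ContinuousConstSMul G Y] {ν : Y → Measure C(Y, ℝ)}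

theorem IsContractingSetup.measure_compl_conicalSet [ProperSpace Y] (H : IsContractingSetup o C f)
    (hC : 0 < C) (hν : IsFiniteDensity G o ω ν) (hω : 0 < ω)
    (hdiv : ¬ Summable fun g : G => poincareTerm o ω g) :
    ν o (conicalSet G o)ᶜ = 0 := by
  have hE := H.measurableSet_recurrentSet.compl
  have hres := hν.restrict hE fun g : G => by
    rw [Set.preimage_compl, preimage_recurrentSet]
  have hzero : ν o (recurrentSet o f C)ᶜ = 0 := by
    by_contra h0
    have hpos := H.measure_infinite_pos hres hω (by rwa [Measure.restrict_apply_univ]) hdiv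
    refine hpos.ne' ?_
    have hsub : {ξ | {g : G | g ∈ minReps o f ∧ ξ ∈ escapeSet o f C g}.Infinite} ⊆
        recurrentSet o f C := fun ξ hξ => ⟨1, by simpa using hξ⟩
    refine measure_mono_null hsub ?_
    rw [Measure.restrict_apply H.measurableSet_recurrentSet, Set.inter_compl_self, measure_empty]
  refine measure_mono_null (fun ξ hξ => ?_)
    (measure_union_null hzero (ae_iff.1 (hν.ae_isHoroPoint o)))
  by_contra! hn
  simp only [Set.mem_union, Set.mem_compl_iff, mem_ofPred_eq, not_or, not_not] at hn
  exact hξ (H.mem_conicalSet hC hn.2 hn.1)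

theorem IsFiniteDensity.measure_conicalSet (hν : IsFiniteDensity G o ω ν) (hω : 0 ≤ ω)
    (hsum : Summable fun g : G => poincareTerm o ω g) :
    ν o (conicalSet G o) = 0 := by
  have := hν.finite o
  have hfin : ∀ᵐ ξ ∂ν o, ∀ (r : ℕ) (g₀ : G),
      {g : G | ξ ∈ usualShadow o (g₀ • o) (g • o) r}.Finite := by
    refine ae_all_iff.2 fun r => ae_all_iff.2 fun g₀ => ae_finite_setOfPred_mem ?_
    set D := Real.exp (ω * (2 * r + 2 * dist o (g₀ • o))) * (ν o).real Set.univ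
    refine ne_top_of_le_ne_top (hsum.mul_left D).tsum_ofReal_ne_top
      (ENNReal.tsum_le_tsum fun g => ?_)
    rw [← ofReal_measureReal]
    exact ENNReal.ofReal_le_ofReal
      (hν.real_usualShadow_le hω (g₀ • o) g r fun ξ hξ _ => hξ)
  refine measure_mono_null (fun ξ hξ => ?_) (ae_iff.1 hfin)
  intro hfinite
  obtain ⟨r, -, g₀, u, hu, hmem⟩ := hξ
  obtain ⟨n, hn⟩ := exists_nat_ge r
  obtain ⟨M, hM⟩ := ((hfinite n g₀).image fun g => dist o (g • o)).bddAbove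
  obtain ⟨m, hm⟩ := (hu.eventually_gt_atTop M).exists
  exact hm.not_ge (hM ⟨u m, usualShadow_mono hn (hmem m), rfl⟩)

end ConicalSet

/-- Hopf–Tsuji–Sullivan dichotomy on the horofunction boundary: the
Poincaré series diverges at `s = ω` iff the conical set has positive `μ_o`-measure
iff it has full `μ_o`-measure; in that case `ω = ω_G`. -/
theorem statement18 {Y G : Type*} [MetricSpace Y] [ProperSpace Y]
    [Group G] [MulAction G Y] [Countable G] [ContinuousConstSMul G Y]
    [MeasurableSpace C(Y, ℝ)] [BorelSpace C(Y, ℝ)]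
    (hY : GeodesicSpace Y) (hiso : IsometricAction G Y)
    (hprop : ProperAction G Y) (hne : NonElementary G) (o : Y)
    (hcontr : ∃ f : G, IsContractingEltAny o f)
    (ω : ℝ) (hω : 0 < ω) (μ : Y → MeasureTheory.Measure C(Y, ℝ))
    (hμ : IsConformalDensity G o ω μ) :
    ((¬ Summable (fun g : G => Real.exp (-ω * dist o (g • o)))) ↔
      0 < μ o (conicalSet G o)) ∧
    ((¬ Summable (fun g : G => Real.exp (-ω * dist o (g • o)))) ↔
      μ o ((conicalSet G o)ᶜ) = 0) ∧
    ((¬ Summable (fun g : G => Real.exp (-ω * dist o (g • o)))) →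
      ω = critExp G o (Set.univ : Set G)) := by
  obtain ⟨f, C, hC, hf⟩ := hcontr
  have H : IsContractingSetup o C f := ⟨hY, hiso, hprop, by linarith, hf⟩
  have hν := hμ.isFiniteDensity
  have hone : μ o Set.univ = 1 := hμ.2.2.1
  have hfull (hdiv : ¬ Summable fun g : G => poincareTerm o ω g) : μ o (conicalSet G o)ᶜ = 0 :=
    H.measure_compl_conicalSet (by linarith) hν hω hdiv
  have hnull (hsum : Summable fun g : G => poincareTerm o ω g) : μ o (conicalSet G o) = 0 :=
    hν.measure_conicalSet hω.le hsum
  have hnot : μ o (conicalSet G o) = 0 → μ o (conicalSet G o)ᶜ ≠ 0 := fun h1 h2 => by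
    have := measure_union_null h1 h2
    rw [Set.union_compl_self, hone] at this
    exact one_ne_zero this
  refine ⟨⟨fun hdiv => pos_iff_ne_zero.2 fun h => hnot h (hfull hdiv),
    fun hpos hsum => hpos.ne' (hnull hsum)⟩,
    ⟨hfull, fun h hsum => hnot (hnull hsum) h⟩, fun hdiv => ?_⟩
  obtain ⟨A, hA, hcard⟩ := H.exists_card_ball_le hν hω (by simp [hone])
  exact hprop.eq_critExp hω.le hdiv hA hcard

end ConfDyn
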